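/- arXiv:2503.15839 — 4 statements merged into one kernel-verified Lean document; each statement's English description precedes it below -/
import Mathlib

section
/- There exists a constant R₀ > 0, depending only on (γ, r₀, b₀, ρ₀, U₀, S₀, E₀), such that for every r₁ ∈ (r₀, r₀ + R₀) the background ODE system with initial data Ū(r₀) = U₀, Ē(r₀) = E₀ has a unique smooth solution (Ū, Ē) on [r₀, r₁], and this solution satisfies U_♯ < Ū(r) < U^♯ and Ū(r)² > c̄²(r) for all r ∈ [r₀, r₁]. -/
open Set

/-- The squared sound speed `c̄²(r) = γ e^{S₀} ρ̄(r)^{γ−1}` of the background flow,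
where `ρ̄(r) = J₀/(r Ū(r))`. -/
noncomputable def soundSpeedSq (γ S₀ J₀ : ℝ) (U : ℝ → ℝ) (r : ℝ) : ℝ :=
  γ * Real.exp S₀ * (J₀ / (r * U r)) ^ (γ - 1)

/-- `(U, E)` is a smooth solution on `[r₀, r₁]` of the background ODE system
with initial data `(U₀, E₀)` at `r₀`, staying positive and satisfying the
bounds `Us < U < Us'` and the supersonic condition `U² > c̄²`. -/
def IsBackgroundSol (γ S₀ b₀ J₀ r₀ r₁ U₀ E₀ Us Us' : ℝ) (U E : ℝ → ℝ) : Prop :=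
  ContDiffOn ℝ (⊤ : ℕ∞) U (Icc r₀ r₁) ∧ ContDiffOn ℝ (⊤ : ℕ∞) E (Icc r₀ r₁) ∧
  U r₀ = U₀ ∧ E r₀ = E₀ ∧
  ∀ r ∈ Icc r₀ r₁,
    0 < U r ∧
    HasDerivWithinAt U
      ((r * U r * E r + soundSpeedSq γ S₀ J₀ U r * U r) /
        (r * ((U r) ^ 2 - soundSpeedSq γ S₀ J₀ U r))) (Icc r₀ r₁) r ∧
    HasDerivWithinAt E (J₀ / (r * U r) - b₀ - E r / r) (Icc r₀ r₁) r ∧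
    Us < U r ∧ U r < Us' ∧
    soundSpeedSq γ S₀ J₀ U r < (U r) ^ 2

open Topology

/-- The background vector field in the extended phase space of points `(r, U, E)`. -/
noncomputable def backgroundField (γ S₀ b₀ J₀ : ℝ) (p : ℝ × ℝ × ℝ) : ℝ × ℝ × ℝ :=
  (1, (p.1 * p.2.1 * p.2.2 + soundSpeedSq γ S₀ J₀ (fun _ => p.2.1) p.1 * p.2.1) /
      (p.1 * (p.2.1 ^ 2 - soundSpeedSq γ S₀ J₀ (fun _ => p.2.1) p.1)),
    J₀ / (p.1 * p.2.1) - b₀ - p.2.2 / p.1)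

/-- The supersonic region of the extended phase space. -/
def supersonicRegion (γ S₀ J₀ : ℝ) : Set (ℝ × ℝ × ℝ) :=
  {p | 0 < p.1 ∧ 0 < p.2.1 ∧ soundSpeedSq γ S₀ J₀ (fun _ => p.2.1) p.1 < p.2.1 ^ 2}

lemma contDiffAt_soundSpeedSq {γ S₀ J₀ : ℝ} (hJ : 0 < J₀) {p : ℝ × ℝ × ℝ}
    (h1 : 0 < p.1) (h2 : 0 < p.2.1) {n : WithTop ℕ∞} :
    ContDiffAt ℝ n
      (fun q : ℝ × ℝ × ℝ => soundSpeedSq γ S₀ J₀ (fun _ => q.2.1) q.1) p := by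
  have hne : p.1 * p.2.1 ≠ 0 := by positivity
  have hρ : ContDiffAt ℝ n (fun q : ℝ × ℝ × ℝ => J₀ / (q.1 * q.2.1)) p :=
    contDiffAt_const.div (contDiffAt_fst.mul contDiffAt_snd.fst) hne
  exact contDiffAt_const.mul (hρ.rpow_const_of_ne (div_ne_zero hJ.ne' hne))

lemma contDiffAt_backgroundField {γ S₀ b₀ J₀ : ℝ} (hJ : 0 < J₀) {p : ℝ × ℝ × ℝ}
    (hp : p ∈ supersonicRegion γ S₀ J₀) {n : WithTop ℕ∞} :
    ContDiffAt ℝ n (backgroundField γ S₀ b₀ J₀) p := by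
  obtain ⟨h1, h2, h3⟩ := hp
  have hc := contDiffAt_soundSpeedSq (γ := γ) (S₀ := S₀) hJ h1 h2 (n := n)
  have hr : ContDiffAt ℝ n (fun q : ℝ × ℝ × ℝ => q.1) p := contDiffAt_fst
  have hU : ContDiffAt ℝ n (fun q : ℝ × ℝ × ℝ => q.2.1) p := contDiffAt_snd.fst
  have hE : ContDiffAt ℝ n (fun q : ℝ × ℝ × ℝ => q.2.2) p := contDiffAt_snd.snd
  exact contDiffAt_const.prodMk
    (((((hr.mul hU).mul hE).add (hc.mul hU)).div (hr.mul ((hU.pow 2).sub hc))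
      (mul_pos h1 (sub_pos.2 h3)).ne').prodMk
    (((contDiffAt_const.div (hr.mul hU) (mul_pos h1 h2).ne').sub contDiffAt_const).sub
      (hE.div hr h1.ne')))

/-- Two integral curves on `[a, b]` of a vector field that is `C¹` near every point of a region
containing both curves agree if they agree at `a`. -/
lemma eqOn_Icc_of_hasDerivWithinAt_of_contDiffAt {E : Type*} [NormedAddCommGroup E]
    [NormedSpace ℝ E] {v : E → E} {Ω : Set E} {f g : ℝ → E} {a b : ℝ}
    (hv : ∀ p ∈ Ω, ContDiffAt ℝ 1 v p)
    (hf : ∀ t ∈ Icc a b, HasDerivWithinAt f (v (f t)) (Icc a b) t)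
    (hfΩ : MapsTo f (Icc a b) Ω)
    (hg : ∀ t ∈ Icc a b, HasDerivWithinAt g (v (g t)) (Icc a b) t)
    (hgΩ : MapsTo g (Icc a b) Ω) (hfg : f a = g a) :
    EqOn f g (Icc a b) := by
  have hfc : ContinuousOn f (Icc a b) := HasDerivWithinAt.continuousOn hf
  have hgc : ContinuousOn g (Icc a b) := HasDerivWithinAt.continuousOn hg
  have hK : IsCompact (f '' Icc a b ∪ g '' Icc a b) :=
    (isCompact_Icc.image_of_continuousOn hfc).union (isCompact_Icc.image_of_continuousOn hgc)
  have hΩ : f '' Icc a b ∪ g '' Icc a b ⊆ Ω :=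
    union_subset hfΩ.image_subset hgΩ.image_subset
  have hloc : LocallyLipschitzOn (f '' Icc a b ∪ g '' Icc a b) v := fun p hp => by
    obtain ⟨K, t, ht, hL⟩ := (hv p (hΩ hp)).exists_lipschitzOnWith
    exact ⟨K, t, mem_nhdsWithin_of_mem_nhds ht, hL⟩
  obtain ⟨K, hL⟩ := hloc.exists_lipschitzOnWith_of_compact hK
  have hright : ∀ {h : ℝ → E}, (∀ t ∈ Icc a b, HasDerivWithinAt h (v (h t)) (Icc a b) t) →
      ∀ t ∈ Ico a b, HasDerivWithinAt h (v (h t)) (Ici t) t := fun hh t ht =>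
    (hh t (Ico_subset_Icc_self ht)).mono_of_mem_nhdsWithin (Icc_mem_nhdsGE_of_mem ht)
  exact ODE_solution_unique_of_mem_Icc_right (v := fun _ => v) (fun _ _ => hL)
    hfc (hright hf) (fun t ht => .inl (mem_image_of_mem f (Ico_subset_Icc_self ht)))
    hgc (hright hg) (fun t ht => .inr (mem_image_of_mem g (Ico_subset_Icc_self ht))) hfg

/-- A background solution is an integral curve of `backgroundField` in the supersonic region. -/
lemma IsBackgroundSol.integralCurve {γ S₀ b₀ J₀ r₀ r₁ U₀ E₀ Us Us' : ℝ} {U E : ℝ → ℝ}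
    (hr₀ : 0 < r₀) (h : IsBackgroundSol γ S₀ b₀ J₀ r₀ r₁ U₀ E₀ Us Us' U E) :
    (∀ r ∈ Icc r₀ r₁, HasDerivWithinAt (fun r => (r, U r, E r))
      (backgroundField γ S₀ b₀ J₀ (r, U r, E r)) (Icc r₀ r₁) r) ∧
    MapsTo (fun r => (r, U r, E r)) (Icc r₀ r₁) (supersonicRegion γ S₀ J₀) := by
  obtain ⟨-, -, -, -, h⟩ := h
  refine ⟨fun r hr => ?_, fun r hr => ?_⟩
  · obtain ⟨-, hU, hE, -⟩ := h r hr
    exact (hasDerivWithinAt_id r _).prodMk (hU.prodMk hE)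
  · obtain ⟨hU, -, -, -, -, hs⟩ := h r hr
    exact ⟨hr₀.trans_le hr.1, hU, hs⟩

lemma IsBackgroundSol.eqOn {γ S₀ b₀ J₀ r₀ r₁ U₀ E₀ Us Us' : ℝ} {U E U' E' : ℝ → ℝ}
    (hr₀ : 0 < r₀) (hJ : 0 < J₀)
    (h : IsBackgroundSol γ S₀ b₀ J₀ r₀ r₁ U₀ E₀ Us Us' U E)
    (h' : IsBackgroundSol γ S₀ b₀ J₀ r₀ r₁ U₀ E₀ Us Us' U' E') :
    EqOn U U' (Icc r₀ r₁) ∧ EqOn E E' (Icc r₀ r₁) := by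
  have hinit : (r₀, U r₀, E r₀) = (r₀, U' r₀, E' r₀) := by
    rw [h.2.2.1, h.2.2.2.1, h'.2.2.1, h'.2.2.2.1]
  have key := eqOn_Icc_of_hasDerivWithinAt_of_contDiffAt
    (fun p hp => contDiffAt_backgroundField (b₀ := b₀) hJ hp) (h.integralCurve hr₀).1
    (h.integralCurve hr₀).2 (h'.integralCurve hr₀).1 (h'.integralCurve hr₀).2 hinit
  exact ⟨fun r hr => congrArg (fun p : ℝ × ℝ × ℝ => p.2.1) (key hr),
    fun r hr => congrArg (fun p : ℝ × ℝ × ℝ => p.2.2) (key hr)⟩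

/-- Initial data in the supersonic region launch a background solution on every sufficiently
short interval. -/
lemma exists_isBackgroundSol {γ S₀ b₀ J₀ r₀ U₀ E₀ Us Us' : ℝ} (hJ : 0 < J₀)
    (h₀ : (r₀, U₀, E₀) ∈ supersonicRegion γ S₀ J₀) (hlo : Us < U₀) (hhi : U₀ < Us') :
    ∃ R₀ > (0 : ℝ), ∀ r₁ ∈ Ioo r₀ (r₀ + R₀), ∃ U E : ℝ → ℝ,
      IsBackgroundSol γ S₀ b₀ J₀ r₀ r₁ U₀ E₀ Us Us' U E := by
  obtain ⟨α, hα₀, ε, hε, hα⟩ :=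
    (contDiffAt_backgroundField (b₀ := b₀) hJ h₀
      (n := 1)).exists_forall_mem_closedBall_exists_eq_forall_mem_Ioo_hasDerivAt₀ r₀
  have hαc : ContinuousAt α r₀ := (hα r₀ ⟨by linarith, by linarith⟩).continuousAt
  have hev : ∀ᶠ p in 𝓝 (α r₀), p ∈ supersonicRegion γ S₀ J₀ ∧ Us < p.2.1 ∧ p.2.1 < Us' := by
    rw [hα₀]
    have hU : ContinuousAt (fun q : ℝ × ℝ × ℝ => q.2.1) (r₀, U₀, E₀) := by fun_prop
    have hc := (contDiffAt_soundSpeedSq (γ := γ) (S₀ := S₀) hJ h₀.1 h₀.2.1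
      (n := 0)).continuousAt
    filter_upwards [continuousAt_fst.eventually_const_lt h₀.1, hU.eventually_const_lt h₀.2.1,
      hc.eventually_lt (hU.pow 2) h₀.2.2, hU.eventually_const_lt hlo, hU.eventually_lt_const hhi]
      with p h1 h2 h3 h4 h5 using ⟨⟨h1, h2, h3⟩, h4, h5⟩
  obtain ⟨δ, hδ, hball⟩ := Metric.eventually_nhds_iff.1 (hαc.eventually hev)
  refine ⟨min ε δ, lt_min hε hδ, fun r₁ hr₁ =>
    ⟨fun r => (α r).2.1, fun r => (α r).2.2, ?_⟩⟩
  have hlt : r₁ < r₀ + ε ∧ r₁ < r₀ + δ :=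
    ⟨hr₁.2.trans_le (by gcongr; exact min_le_left _ _),
      hr₁.2.trans_le (by gcongr; exact min_le_right _ _)⟩
  have hderiv : ∀ r ∈ Icc r₀ r₁, HasDerivAt α (backgroundField γ S₀ b₀ J₀ (α r)) r :=
    fun r hr => hα r ⟨by linarith [hr.1], by linarith [hr.2]⟩
  have hmem : ∀ r ∈ Icc r₀ r₁,
      α r ∈ supersonicRegion γ S₀ J₀ ∧ Us < (α r).2.1 ∧ (α r).2.1 < Us' := fun r hr =>
    hball (by rw [Real.dist_eq, abs_lt]; constructor <;> linarith [hr.1, hr.2])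
  have hsmooth : ContDiffOn ℝ (⊤ : ℕ∞) α (Icc r₀ r₁) :=
    ODE.contDiffOn_enat_Icc_of_hasDerivWithinAt (f := fun _ => backgroundField γ S₀ b₀ J₀)
      (u := supersonicRegion γ S₀ J₀)
      (fun q hq => ((contDiffAt_backgroundField hJ hq.2).comp q
        contDiffAt_snd).contDiffWithinAt)
      (fun r hr => (hderiv r hr).hasDerivWithinAt) (fun r hr => (hmem r hr).1)
  have htime : ∀ r ∈ Icc r₀ r₁, (α r).1 = r := by
    have hd : ∀ r ∈ Icc r₀ r₁, HasDerivAt (fun r => (α r).1 - r) 0 r := fun r hr => by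
      have h : HasDerivAt (fun r => (α r).1) 1 r :=
        (hderiv r hr).hasFDerivAt.fst.hasDerivAt.congr_deriv (by simp [backgroundField])
      exact (h.sub (hasDerivAt_id' r)).congr_deriv (sub_self 1)
    intro r hr
    have := constant_of_has_deriv_right_zero
      (fun r hr => (hd r hr).continuousAt.continuousWithinAt)
      (fun r hr => (hd r (Ico_subset_Icc_self hr)).hasDerivWithinAt) r hr
    simp only [hα₀, sub_self] at this
    exact sub_eq_zero.1 this
  refine ⟨hsmooth.snd.fst, hsmooth.snd.snd, by simp [hα₀], by simp [hα₀], fun r hr => ?_⟩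
  obtain ⟨⟨-, h2, h3⟩, h4, h5⟩ := hmem r hr
  have hd := (hderiv r hr).hasDerivWithinAt (s := Icc r₀ r₁)
  have hdU := hd.snd.fst
  have hdE := hd.snd.snd
  simp only [backgroundField, htime r hr] at h3 hdU hdE
  exact ⟨h2, hdU, hdE, h4, h5, h3⟩

/-- The lower bound `U_♯ < U₀` says exactly that the initial state is supersonic. -/
lemma soundSpeedSq_lt_sq {γ S₀ J₀ r₀ U₀ : ℝ} (hγ : 1 < γ) (hr₀ : 0 < r₀) (hJ : 0 < J₀)
    (hU₀ : 0 < U₀)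
    (hlo : (γ * Real.exp S₀ * J₀ ^ (γ - 1) / r₀ ^ (γ - 1)) ^ (1 / (γ + 1)) < U₀) :
    soundSpeedSq γ S₀ J₀ (fun _ => U₀) r₀ < U₀ ^ 2 := by
  have hγ0 : 0 < γ := by linarith
  have hA : 0 ≤ γ * Real.exp S₀ * J₀ ^ (γ - 1) / r₀ ^ (γ - 1) := by positivity
  rw [one_div, Real.rpow_inv_lt_iff_of_pos hA hU₀.le (by linarith),
    show γ + 1 = 2 + (γ - 1) by ring, Real.rpow_add hU₀, Real.rpow_two] at hlo
  rw [soundSpeedSq, Real.div_rpow hJ.le (by positivity), Real.mul_rpow hr₀.le hU₀.le,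
    ← div_div, ← mul_div_assoc, ← mul_div_assoc, div_lt_iff₀ (by positivity)]
  exact hlo

/-- existence of `R₀ > 0` (depending only on the data) such that
for every `r₁ ∈ (r₀, r₀ + R₀)` the background ODE system with initial data
`Ū(r₀) = U₀`, `Ē(r₀) = E₀` has a unique smooth solution on `[r₀, r₁]`
satisfying `U_♯ < Ū < U^♯` and `Ū² > c̄²`. -/
theorem stmt_0 (γ r₀ b₀ ρ₀ U₀ S₀ E₀ : ℝ)
    (hγ : 1 < γ) (hγ2 : γ ≠ 2) (hr₀ : 0 < r₀) (hb₀ : 0 < b₀) (hρ₀ : 0 < ρ₀)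
    (hU₀ : 0 < U₀) (hS₀ : 0 < S₀)
    (hJpos : 0 < r₀ * ρ₀ * U₀)
    (hJ : r₀ * ρ₀ * U₀ <
      (r₀ ^ (2 * (2 * γ - 1)) / (2 ^ (γ + 1) * (γ * Real.exp S₀) ^ (3 : ℝ)))
        ^ (1 / (2 * (γ - 2))))
    (hUlo : (γ * Real.exp S₀ * (r₀ * ρ₀ * U₀) ^ (γ - 1) / r₀ ^ (γ - 1))
        ^ (1 / (γ + 1)) < U₀)
    (hUhi : U₀ < (2 * r₀ * (r₀ * ρ₀ * U₀)) ^ ((1 : ℝ) / 3)) :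
    ∃ R₀ > (0 : ℝ), ∀ r₁ ∈ Ioo r₀ (r₀ + R₀),
      ∃ U E : ℝ → ℝ,
        IsBackgroundSol γ S₀ b₀ (r₀ * ρ₀ * U₀) r₀ r₁ U₀ E₀
          ((γ * Real.exp S₀ * (r₀ * ρ₀ * U₀) ^ (γ - 1) / r₀ ^ (γ - 1)) ^ (1 / (γ + 1)))
          ((2 * r₀ * (r₀ * ρ₀ * U₀)) ^ ((1 : ℝ) / 3)) U E ∧
        ∀ U' E' : ℝ → ℝ,
          IsBackgroundSol γ S₀ b₀ (r₀ * ρ₀ * U₀) r₀ r₁ U₀ E₀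
            ((γ * Real.exp S₀ * (r₀ * ρ₀ * U₀) ^ (γ - 1) / r₀ ^ (γ - 1)) ^ (1 / (γ + 1)))
            ((2 * r₀ * (r₀ * ρ₀ * U₀)) ^ ((1 : ℝ) / 3)) U' E' →
          EqOn U U' (Icc r₀ r₁) ∧ EqOn E E' (Icc r₀ r₁) := by
  obtain ⟨R₀, hR₀, hex⟩ := exists_isBackgroundSol (b₀ := b₀) (E₀ := E₀) hJpos
    ⟨hr₀, hU₀, soundSpeedSq_lt_sq hγ hr₀ hJpos hU₀ hUlo⟩ hUlo hUhi
  refine ⟨R₀, hR₀, fun r₁ hr₁ => ?_⟩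
  obtain ⟨U, E, hsol⟩ := hex r₁ hr₁
  exact ⟨U, E, hsol, fun U' E' hsol' => hsol.eqOn hr₀ hJpos hsol'⟩
end

section
/- Given r₀ > 0 and constants 𝔞₀ > 0, 𝔞₂ > 0 and 𝔞₁ ∈ ℝ, there exist a number r₁ > r₀, a constant λ₀ > 0, and a continuously differentiable function Z : [r₀, r₁] → ℝ with Z(r) > 0 for all r ∈ [r₀, r₁], such that −Z′(r) − 𝔞₂ Z(r)² + 2𝔞₁ Z(r) − 𝔞₀ = λ₀ for all r ∈ [r₀, r₁]. -/
/-- existence of a positive `C¹` multiplier `Z` solving the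
Riccati-type ODE `−Z′ − 𝔞₂Z² + 2𝔞₁Z − 𝔞₀ = λ₀` on some interval `[r₀, r₁]`
with a positive constant `λ₀`. -/
theorem stmt_4 (r₀ a₀ a₁ a₂ : ℝ) (hr₀ : 0 < r₀) (ha₀ : 0 < a₀) (ha₂ : 0 < a₂) :
    ∃ r₁ > r₀, ∃ lam₀ > (0 : ℝ), ∃ Z Z' : ℝ → ℝ,
      (∀ r ∈ Set.Icc r₀ r₁, HasDerivWithinAt Z (Z' r) (Set.Icc r₀ r₁) r) ∧
      ContinuousOn Z' (Set.Icc r₀ r₁) ∧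
      (∀ r ∈ Set.Icc r₀ r₁, 0 < Z r) ∧
      (∀ r ∈ Set.Icc r₀ r₁, -Z' r - a₂ * Z r ^ 2 + 2 * a₁ * Z r - a₀ = lam₀) := by
  -- The solution is `(a₁ + ω tan (β - ω (r - r₀))) / a₂` with `ω ^ 2 = 1 + a₀ a₂`.
  obtain ⟨ω, hω, hωsq⟩ : ∃ ω : ℝ, 0 < ω ∧ ω ^ 2 = 1 + a₀ * a₂ :=
    ⟨√(1 + a₀ * a₂), by positivity, Real.sq_sqrt (by positivity)⟩
  set α := Real.arctan ((|a₁| + 1) / ω) with hα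
  set β := Real.arctan ((|a₁| + 2) / ω) with hβ
  have hαβ : α < β := Real.arctan_strictMono (by gcongr; norm_num)
  have hα_gt : -(Real.pi / 2) < α := Real.neg_pi_div_two_lt_arctan _
  have hβ_lt : β < Real.pi / 2 := Real.arctan_lt_pi_div_two _
  set r₁ := r₀ + (β - α) / ω with hr₁
  set θ : ℝ → ℝ := fun r => β - ω * (r - r₀) with hθ
  set Z : ℝ → ℝ := fun r => (a₁ + ω * Real.tan (θ r)) / a₂ with hZ
  set Z' : ℝ → ℝ := fun r => -a₂ * Z r ^ 2 + 2 * a₁ * Z r - (ω ^ 2 + a₁ ^ 2) / a₂ with hZ'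
  have hθ_mem : ∀ r ∈ Set.Icc r₀ r₁, α ≤ θ r ∧ θ r ≤ β := by
    rintro r ⟨h₀, h₁⟩
    have h : (r - r₀) * ω ≤ β - α := (le_div_iff₀ hω).1 (by linarith)
    have h' : 0 ≤ ω * (r - r₀) := mul_nonneg hω.le (by linarith)
    simp only [hθ]
    constructor <;> linarith
  have hderiv : ∀ r ∈ Set.Icc r₀ r₁, HasDerivWithinAt Z (Z' r) (Set.Icc r₀ r₁) r := by
    intro r hr
    obtain ⟨h₀, h₁⟩ := hθ_mem r hr
    have hcos : Real.cos (θ r) ≠ 0 :=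
      (Real.cos_pos_of_mem_Ioo ⟨by linarith, by linarith⟩).ne'
    have hθ_deriv : HasDerivAt θ (-(ω * 1)) r :=
      (((hasDerivAt_id r).sub_const r₀).const_mul ω).const_sub β
    have hZ_deriv :=
      ((((Real.hasDerivAt_tan hcos).comp r hθ_deriv).const_mul ω).const_add a₁).div_const a₂
    refine (hZ_deriv.congr_deriv ?_).hasDerivWithinAt
    have hsec : 1 / Real.cos (θ r) ^ 2 = 1 + Real.tan (θ r) ^ 2 := by
      rw [← Real.inv_one_add_tan_sq hcos, one_div, inv_inv]
    rw [hsec]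
    simp only [hZ', hZ]
    field_simp
    ring
  have hcont : ContinuousOn Z (Set.Icc r₀ r₁) := fun r hr => (hderiv r hr).continuousWithinAt
  refine ⟨r₁, ?_, (1 + a₁ ^ 2) / a₂, by positivity, Z, Z', hderiv, ?_, ?_, ?_⟩
  · have : 0 < (β - α) / ω := div_pos (by linarith) hω
    linarith
  · simp only [hZ']
    fun_prop
  · intro r hr
    obtain ⟨h₀, h₁⟩ := hθ_mem r hr
    have htan : Real.tan α ≤ Real.tan (θ r) :=
      Real.strictMonoOn_tan.monotoneOn ⟨hα_gt, by linarith⟩ ⟨by linarith, by linarith⟩ h₀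
    rw [hα, Real.tan_arctan, div_le_iff₀ hω] at htan
    refine div_pos ?_ ha₂
    linarith [neg_abs_le a₁]
  · intro r _
    simp only [hZ', hωsq]
    field_simp
    ring
end

section
/- Let μ₁ ∈ (0,1). For each ε₀ ∈ (0, R₀) there exist r̄₁* ∈ (r₀, r₀ + R₀ − ε₀] and δ₁ > 0, depending only on (γ, r₀, b₀, ρ₀, U₀, S₀, E₀, θ₀, μ₁, ε₀), with the following property. Let r₁ ∈ (r₀, r̄₁*); then there exists a constant C > 0 such that: whenever A_{ij} ∈ C^∞(closure of Ω) for 1 ≤ i ≤ j ≤ 3 satisfy (a) μ₁ ≤ −A₁₁ ≤ 1/μ₁ and μ₁ ≤ A₂₂ ≤ 1/μ₁ and μ₁ ≤ A₃₃ ≤ 1/μ₁ on the closure of Ω; (b) (μ₁/2)(ξ₂² + ξ₃²) ≤ A₂₂ξ₂² + 2A₂₃ξ₂ξ₃ + A₃₃ξ₃² for all (ξ₂, ξ₃) ∈ ℝ²; (c) A₁₂ = A₂₃ = 0 on θ = ±θ₀ and A₁₃ = A₂₃ = 0 on z = ±1; (d) the C¹(closure of Ω)-norms of A₁₁ − Ā₁₁,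 A₂₂ − Ā₂₂, A₃₃ − Ā₃₃, A₁₂, A₁₃, A₂₃ are each at most δ₁; and whenever ψ, Ψ̂ ∈ C²(closure of Ω) and continuous functions F₃, F₄ on the closure of Ω and F₅ on the closure of D satisfy, in Ω, A₁₁∂_r²ψ + 2A₁₂∂²_{rθ}ψ + 2A₁₃∂²_{rz}ψ + A₂₂∂_θ²ψ + 2A₂₃∂²_{θz}ψ + A₃₃∂_z²ψ + ā₁∂_rψ + b̄₁∂_rΨ̂ + b̄₂Ψ̂ = F₃ and ∂_r²Ψ̂ + (1/r)∂_rΨ̂ + (1/r²)∂_θ²Ψ̂ + ∂_z²Ψ̂ + ā₂∂_rψ − b̄₃Ψ̂ = F₄, with boundary conditions ψ(r₀,θ,z) = 0, ∂_rψ(r₀,θ,z) = F₅(θ,z), ∂_rΨ̂(r₀,θ,z) = 0, Ψ̂(r₁,θ,z) = 0, ∂_θψ = ∂_θΨ̂ = 0 on θ = ±θ₀, and ∂_zψ = ∂_zΨ̂ = 0 on z = ±1; then ∫_Ω (ψ² + (∂_rψ)² + (∂_θψ)² + (∂_zψ)² + Ψ̂² + (∂_rΨ̂)² + (∂_θΨ̂)²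 + (∂_zΨ̂)²) dr dθ dz ≤ C (∫_Ω (F₃² + F₄²) dr dθ dz + ∫_D F₅² dθ dz). -/
open Set MeasureTheory

/-- The open cylindrical box `Ω = (r₀,r₁) × (−θ₀,θ₀) × (−1,1)` in the
coordinates `(r, θ, z)`. -/
def Cyl (r₀ r₁ θ₀ : ℝ) : Set (ℝ × ℝ × ℝ) :=
  Ioo r₀ r₁ ×ˢ Ioo (-θ₀) θ₀ ×ˢ Ioo (-1 : ℝ) 1

/-- The cross-section `D = (−θ₀,θ₀) × (−1,1)`. -/
def CrossD (θ₀ : ℝ) : Set (ℝ × ℝ) := Ioo (-θ₀) θ₀ ×ˢ Ioo (-1 : ℝ) 1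

/-- unit direction `e_r`. -/
def er : ℝ × ℝ × ℝ := (1, 0, 0)
/-- unit direction `e_θ`. -/
def eθ : ℝ × ℝ × ℝ := (0, 1, 0)
/-- unit direction `e_z`. -/
def ez : ℝ × ℝ × ℝ := (0, 0, 1)

/-- Directional derivative (within a set) of a function on `ℝ³`. -/
noncomputable def pdv (S : Set (ℝ × ℝ × ℝ)) (v : ℝ × ℝ × ℝ) (f : ℝ × ℝ × ℝ → ℝ) :
    ℝ × ℝ × ℝ → ℝ :=
  fun p => fderivWithin ℝ f S p v

/-- Background density `ρ̄(r) = J₀/(r Ū(r))`. -/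
noncomputable def rhoBar (J₀ : ℝ) (U : ℝ → ℝ) (r : ℝ) : ℝ := J₀ / (r * U r)

/-- Background squared sound speed `c̄²(r) = γ e^{S₀} ρ̄(r)^{γ−1}`. -/
noncomputable def c2Bar (γ S₀ J₀ : ℝ) (U : ℝ → ℝ) (r : ℝ) : ℝ :=
  γ * Real.exp S₀ * rhoBar J₀ U r ^ (γ - 1)

/-- Background coefficient `ā₁ = (c̄² − (γ−1)Ū²)/r − (γ+1)ŪŪ′ + Ē`. -/
noncomputable def a1Bar (γ S₀ J₀ : ℝ) (U U' E : ℝ → ℝ) (r : ℝ) : ℝ :=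
  (c2Bar γ S₀ J₀ U r - (γ - 1) * (U r) ^ 2) / r - (γ + 1) * (U r * U' r) + E r

/-- Background coefficient `ā₂ = ρ̄Ū/c̄²`. -/
noncomputable def a2Bar (γ S₀ J₀ : ℝ) (U : ℝ → ℝ) (r : ℝ) : ℝ :=
  rhoBar J₀ U r * U r / c2Bar γ S₀ J₀ U r

/-- Background coefficient `b̄₂ = (γ−1)Ū′ + (γ−1)Ū/r`. -/
noncomputable def b2Bar (γ : ℝ) (U U' : ℝ → ℝ) (r : ℝ) : ℝ :=
  (γ - 1) * U' r + (γ - 1) * U r / r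

/-- Background coefficient `b̄₃ = ρ̄/c̄²`. -/
noncomputable def b3Bar (γ S₀ J₀ : ℝ) (U : ℝ → ℝ) (r : ℝ) : ℝ :=
  rhoBar J₀ U r / c2Bar γ S₀ J₀ U r

/-- Background principal coefficient `Ā₁₁ = c̄² − Ū²`. -/
noncomputable def A11Bar (γ S₀ J₀ : ℝ) (U : ℝ → ℝ) (r : ℝ) : ℝ :=
  c2Bar γ S₀ J₀ U r - (U r) ^ 2

/-- Background principal coefficient `Ā₂₂ = c̄²/r²`. -/
noncomputable def A22Bar (γ S₀ J₀ : ℝ) (U : ℝ → ℝ) (r : ℝ) : ℝ :=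
  c2Bar γ S₀ J₀ U r / r ^ 2

lemma closure_Cyl {r₀ r₁ θ₀ : ℝ} (hr : r₀ < r₁) (hθ : 0 < θ₀) :
    closure (Cyl r₀ r₁ θ₀) = Icc r₀ r₁ ×ˢ Icc (-θ₀) θ₀ ×ˢ Icc (-1 : ℝ) 1 := by
  have h1 : -θ₀ ≠ θ₀ := by linarith
  have h2 : (-1 : ℝ) ≠ 1 := by norm_num
  simp only [Cyl, closure_prod_eq, closure_Ioo hr.ne, closure_Ioo h1, closure_Ioo h2]

lemma isOpen_Cyl (r₀ r₁ θ₀ : ℝ) : IsOpen (Cyl r₀ r₁ θ₀) :=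
  isOpen_Ioo.prod (isOpen_Ioo.prod isOpen_Ioo)

lemma isCompact_closure_Cyl {r₀ r₁ θ₀ : ℝ} (hr : r₀ < r₁) (hθ : 0 < θ₀) :
    IsCompact (closure (Cyl r₀ r₁ θ₀)) := by
  rw [closure_Cyl hr hθ]
  exact isCompact_Icc.prod (isCompact_Icc.prod isCompact_Icc)

lemma uniqueDiffOn_closure_Cyl {r₀ r₁ θ₀ : ℝ} (hr : r₀ < r₁) (hθ : 0 < θ₀) :
    UniqueDiffOn ℝ (closure (Cyl r₀ r₁ θ₀)) := by
  rw [closure_Cyl hr hθ]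
  exact (uniqueDiffOn_Icc hr).prod
    ((uniqueDiffOn_Icc (by linarith)).prod (uniqueDiffOn_Icc (by norm_num)))

lemma closure_Cyl_mem_nhds {r₀ r₁ θ₀ : ℝ} {p : ℝ × ℝ × ℝ} (hp : p ∈ Cyl r₀ r₁ θ₀) :
    closure (Cyl r₀ r₁ θ₀) ∈ nhds p :=
  Filter.mem_of_superset ((isOpen_Cyl r₀ r₁ θ₀).mem_nhds hp) subset_closure

lemma integrableOn_Cyl {r₀ r₁ θ₀ : ℝ} (hr : r₀ < r₁) (hθ : 0 < θ₀) {f : ℝ × ℝ × ℝ → ℝ}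
    (hf : ContinuousOn f (closure (Cyl r₀ r₁ θ₀))) : IntegrableOn f (Cyl r₀ r₁ θ₀) :=
  (hf.integrableOn_compact (isCompact_closure_Cyl hr hθ)).mono_set subset_closure

lemma contDiffOn_pdv {S : Set (ℝ × ℝ × ℝ)} (hS : UniqueDiffOn ℝ S) (v : ℝ × ℝ × ℝ)
    {f : ℝ × ℝ × ℝ → ℝ} {m n : WithTop ℕ∞} (hf : ContDiffOn ℝ n f S) (hmn : m + 1 ≤ n) :
    ContDiffOn ℝ m (pdv S v f) S :=
  (hf.fderivWithin hS hmn).clm_apply contDiffOn_const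

lemma continuousOn_pdv {S : Set (ℝ × ℝ × ℝ)} (hS : UniqueDiffOn ℝ S) (v : ℝ × ℝ × ℝ)
    {f : ℝ × ℝ × ℝ → ℝ} (hf : ContDiffOn ℝ 1 f S) : ContinuousOn (pdv S v f) S :=
  (contDiffOn_pdv (m := 0) hS v hf (by simp)).continuousOn

/-- Second directional derivatives of a `C²` function commute on the closed box. -/
lemma pdv_comm {r₀ r₁ θ₀ : ℝ} (hr : r₀ < r₁) (hθ : 0 < θ₀) {f : ℝ × ℝ × ℝ → ℝ}
    (hf : ContDiffOn ℝ 2 f (closure (Cyl r₀ r₁ θ₀))) (v w : ℝ × ℝ × ℝ) {p : ℝ × ℝ × ℝ}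
    (hp : p ∈ Cyl r₀ r₁ θ₀) :
    pdv (closure (Cyl r₀ r₁ θ₀)) v (pdv (closure (Cyl r₀ r₁ θ₀)) w f) p =
      pdv (closure (Cyl r₀ r₁ θ₀)) w (pdv (closure (Cyl r₀ r₁ θ₀)) v f) p := by
  have hS := uniqueDiffOn_closure_Cyl hr hθ
  have hpK := subset_closure hp
  have hsym : IsSymmSndFDerivWithinAt ℝ f (closure (Cyl r₀ r₁ θ₀)) p :=
    (hf p hpK).isSymmSndFDerivWithinAt (by simp) hS
      (subset_closure (mem_interior_iff_mem_nhds.2 (closure_Cyl_mem_nhds hp))) hpK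
  have hd : DifferentiableWithinAt ℝ (fderivWithin ℝ f (closure (Cyl r₀ r₁ θ₀)))
      (closure (Cyl r₀ r₁ θ₀)) p :=
    ((hf.fderivWithin hS (m := 1) (by norm_num)).differentiableOn (by simp)) p hpK
  have key : ∀ a b : ℝ × ℝ × ℝ,
      pdv (closure (Cyl r₀ r₁ θ₀)) a (pdv (closure (Cyl r₀ r₁ θ₀)) b f) p =
        fderivWithin ℝ (fderivWithin ℝ f (closure (Cyl r₀ r₁ θ₀))) (closure (Cyl r₀ r₁ θ₀)) p
          a b := by
    intro a b
    have := hd.hasFDerivWithinAt.clm_apply (hasFDerivWithinAt_const b p (closure (Cyl r₀ r₁ θ₀)))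
    change fderivWithin ℝ (fun q => fderivWithin ℝ f (closure (Cyl r₀ r₁ θ₀)) q b) _ p a = _
    rw [this.fderivWithin (hS p hpK)]
    simp
  rw [key, key]
  exact hsym v w

/-- The fundamental theorem of calculus along a coordinate segment. -/
lemma integral_segment {S : Set (ℝ × ℝ × ℝ)} (hS : UniqueDiffOn ℝ S) {G : ℝ × ℝ × ℝ → ℝ}
    (hG : ContDiffOn ℝ 1 G S) {a b : ℝ} (hab : a < b) (l : ℝ → ℝ × ℝ × ℝ) (v : ℝ × ℝ × ℝ)
    (hl : ∀ t, HasDerivAt l v t) (hS' : ∀ t ∈ Icc a b, l t ∈ S)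
    (hn : ∀ t ∈ Ioo a b, S ∈ nhds (l t)) :
    ∫ t in Ioo a b, pdv S v G (l t) = G (l b) - G (l a) := by
  have hlc : Continuous l := continuous_iff_continuousAt.2 fun t => (hl t).continuousAt
  have hc : ContinuousOn (fun t => pdv S v G (l t)) (Icc a b) :=
    (continuousOn_pdv hS v hG).comp hlc.continuousOn hS'
  rw [← integral_Ioc_eq_integral_Ioo, ← intervalIntegral.integral_of_le hab.le]
  refine intervalIntegral.integral_eq_sub_of_hasDerivAt_of_le hab.le
    (hG.continuousOn.comp hlc.continuousOn hS') (fun t ht => ?_)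
    (hc.intervalIntegrable_of_Icc hab.le)
  have h1 := ((hG.differentiableOn (by simp)) (l t)
    (hS' t (Ioo_subset_Icc_self ht))).hasFDerivWithinAt.hasFDerivAt (hn t ht)
  exact h1.comp_hasDerivAt t (hl t)

lemma volume_restrict_Cyl (r₀ r₁ θ₀ : ℝ) :
    (volume : Measure (ℝ × ℝ × ℝ)).restrict (Cyl r₀ r₁ θ₀) =
      (volume.restrict (Ioo r₀ r₁)).prod (volume.restrict (CrossD θ₀)) := by
  rw [Measure.prod_restrict]; rfl

lemma volume_restrict_CrossD (θ₀ : ℝ) :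
    (volume : Measure (ℝ × ℝ)).restrict (CrossD θ₀) =
      (volume.restrict (Ioo (-θ₀) θ₀)).prod (volume.restrict (Ioo (-1 : ℝ) 1)) := by
  rw [Measure.prod_restrict]; rfl

lemma measurableSet_CrossD (θ₀ : ℝ) : MeasurableSet (CrossD θ₀) :=
  measurableSet_Ioo.prod measurableSet_Ioo

lemma closure_CrossD {θ₀ : ℝ} (hθ : 0 < θ₀) :
    closure (CrossD θ₀) = Icc (-θ₀) θ₀ ×ˢ Icc (-1 : ℝ) 1 := by
  have h1 : -θ₀ ≠ θ₀ := by linarith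
  have h2 : (-1 : ℝ) ≠ 1 := by norm_num
  simp only [CrossD, closure_prod_eq, closure_Ioo h1, closure_Ioo h2]

lemma integrableOn_CrossD {θ₀ : ℝ} (hθ : 0 < θ₀) {f : ℝ × ℝ → ℝ}
    (hf : ContinuousOn f (closure (CrossD θ₀))) : IntegrableOn f (CrossD θ₀) := by
  refine (hf.integrableOn_compact ?_).mono_set subset_closure
  rw [closure_CrossD hθ]
  exact isCompact_Icc.prod isCompact_Icc

lemma integral_pdv_er {r₀ r₁ θ₀ : ℝ} (hr : r₀ < r₁) (hθ : 0 < θ₀) {G : ℝ × ℝ × ℝ → ℝ}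
    (hG : ContDiffOn ℝ 1 G (closure (Cyl r₀ r₁ θ₀))) :
    ∫ p in Cyl r₀ r₁ θ₀, pdv (closure (Cyl r₀ r₁ θ₀)) er G p =
      ∫ q in CrossD θ₀, (G (r₁, q) - G (r₀, q)) := by
  have hS := uniqueDiffOn_closure_Cyl hr hθ
  have hGint := integrableOn_Cyl hr hθ (continuousOn_pdv hS er hG)
  rw [IntegrableOn, volume_restrict_Cyl] at hGint
  rw [volume_restrict_Cyl, integral_prod_symm _ hGint]
  refine setIntegral_congr_fun (measurableSet_CrossD θ₀) fun q hq => ?_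
  refine integral_segment hS hG hr (fun t => (t, q)) er
    (fun t => (hasDerivAt_id t).prodMk (hasDerivAt_const t q)) (fun t ht => ?_)
    (fun t ht => closure_Cyl_mem_nhds ⟨ht, hq⟩)
  rw [closure_Cyl hr hθ]
  exact ⟨ht, Ioo_subset_Icc_self hq.1, Ioo_subset_Icc_self hq.2⟩

lemma integral_pdv_eθ {r₀ r₁ θ₀ : ℝ} (hr : r₀ < r₁) (hθ : 0 < θ₀) {G : ℝ × ℝ × ℝ → ℝ}
    (hG : ContDiffOn ℝ 1 G (closure (Cyl r₀ r₁ θ₀)))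
    (h0 : ∀ p ∈ closure (Cyl r₀ r₁ θ₀), (p.2.1 = θ₀ ∨ p.2.1 = -θ₀) → G p = 0) :
    ∫ p in Cyl r₀ r₁ θ₀, pdv (closure (Cyl r₀ r₁ θ₀)) eθ G p = 0 := by
  have hS := uniqueDiffOn_closure_Cyl hr hθ
  have hc := continuousOn_pdv hS eθ hG
  have hGint := integrableOn_Cyl hr hθ hc
  rw [IntegrableOn, volume_restrict_Cyl] at hGint
  rw [volume_restrict_Cyl, integral_prod _ hGint]
  refine setIntegral_eq_zero_of_forall_eq_zero fun r hrr => ?_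
  have hmem : ∀ q ∈ Icc (-θ₀) θ₀ ×ˢ Icc (-1 : ℝ) 1, (r, q) ∈ closure (Cyl r₀ r₁ θ₀) := by
    intro q hq
    rw [closure_Cyl hr hθ]
    exact ⟨Ioo_subset_Icc_self hrr, hq⟩
  have hi : IntegrableOn (fun q : ℝ × ℝ => pdv (closure (Cyl r₀ r₁ θ₀)) eθ G (r, q))
      (CrossD θ₀) := by
    refine integrableOn_CrossD hθ (hc.comp (by fun_prop) fun q hq => ?_)
    rw [closure_CrossD hθ] at hq
    exact hmem q hq
  rw [IntegrableOn, volume_restrict_CrossD] at hi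
  rw [volume_restrict_CrossD, integral_prod_symm _ hi]
  refine setIntegral_eq_zero_of_forall_eq_zero fun z hz => ?_
  have hz' := Ioo_subset_Icc_self hz
  have := integral_segment hS hG (by linarith : -θ₀ < θ₀) (fun t => (r, t, z)) eθ
    (fun t => (hasDerivAt_const t r).prodMk ((hasDerivAt_id t).prodMk (hasDerivAt_const t z)))
    (fun t ht => hmem (t, z) ⟨ht, hz'⟩)
    (fun t ht => closure_Cyl_mem_nhds ⟨hrr, ht, hz⟩)
  rw [this, h0 _ (hmem (θ₀, z) ⟨⟨by linarith, le_rfl⟩, hz'⟩) (Or.inl rfl),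
    h0 _ (hmem (-θ₀, z) ⟨⟨le_rfl, by linarith⟩, hz'⟩) (Or.inr rfl), sub_zero]

lemma integral_pdv_ez {r₀ r₁ θ₀ : ℝ} (hr : r₀ < r₁) (hθ : 0 < θ₀) {G : ℝ × ℝ × ℝ → ℝ}
    (hG : ContDiffOn ℝ 1 G (closure (Cyl r₀ r₁ θ₀)))
    (h0 : ∀ p ∈ closure (Cyl r₀ r₁ θ₀), (p.2.2 = 1 ∨ p.2.2 = -1) → G p = 0) :
    ∫ p in Cyl r₀ r₁ θ₀, pdv (closure (Cyl r₀ r₁ θ₀)) ez G p = 0 := by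
  have hS := uniqueDiffOn_closure_Cyl hr hθ
  have hc := continuousOn_pdv hS ez hG
  have hGint := integrableOn_Cyl hr hθ hc
  rw [IntegrableOn, volume_restrict_Cyl] at hGint
  rw [volume_restrict_Cyl, integral_prod _ hGint]
  refine setIntegral_eq_zero_of_forall_eq_zero fun r hrr => ?_
  have hmem : ∀ q ∈ Icc (-θ₀) θ₀ ×ˢ Icc (-1 : ℝ) 1, (r, q) ∈ closure (Cyl r₀ r₁ θ₀) := by
    intro q hq
    rw [closure_Cyl hr hθ]
    exact ⟨Ioo_subset_Icc_self hrr, hq⟩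
  have hi : IntegrableOn (fun q : ℝ × ℝ => pdv (closure (Cyl r₀ r₁ θ₀)) ez G (r, q))
      (CrossD θ₀) := by
    refine integrableOn_CrossD hθ (hc.comp (by fun_prop) fun q hq => ?_)
    rw [closure_CrossD hθ] at hq
    exact hmem q hq
  rw [IntegrableOn, volume_restrict_CrossD] at hi
  rw [volume_restrict_CrossD, integral_prod _ hi]
  refine setIntegral_eq_zero_of_forall_eq_zero fun y hy => ?_
  have hy' := Ioo_subset_Icc_self hy
  have := integral_segment hS hG (by norm_num : (-1 : ℝ) < 1) (fun t => (r, y, t)) ez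
    (fun t => (hasDerivAt_const t r).prodMk ((hasDerivAt_const t y).prodMk (hasDerivAt_id t)))
    (fun t ht => hmem (y, t) ⟨hy', ht⟩)
    (fun t ht => closure_Cyl_mem_nhds ⟨hrr, hy, ht⟩)
  rw [this, h0 _ (hmem (y, 1) ⟨hy', by norm_num, le_rfl⟩) (Or.inl rfl),
    h0 _ (hmem (y, -1) ⟨hy', le_rfl, by norm_num⟩) (Or.inr rfl), sub_zero]

lemma abs_mul_mul_le_half {M D : ℝ} (hD : |D| ≤ M) (p q : ℝ) :
    |D * (p * q)| ≤ M / 2 * (p ^ 2 + q ^ 2) := by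
  rw [abs_mul]
  have h1 : |p * q| ≤ (p ^ 2 + q ^ 2) / 2 := by
    rw [abs_le]
    constructor <;> nlinarith [sq_nonneg (p - q), sq_nonneg (p + q)]
  calc |D| * |p * q| ≤ M * ((p ^ 2 + q ^ 2) / 2) :=
        mul_le_mul hD h1 (abs_nonneg _) ((abs_nonneg _).trans hD)
    _ = _ := by ring

/-- The algebraic inequality behind the energy estimate: the divergence of the energy flux
controls the energy density up to the source terms when the thickness `T` is small. -/
lemma energy_density_le {a b c s φ x y u A11 A22 A23 A33 r11 r22 r23 r33 t12 t22 t23 z13 z33 z23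
    a1 U b2 a2 b3 ir ir2 F3 F4 w d T M μ κ lam c0 : ℝ}
    (hμ : 0 < μ) (hμ1 : μ < 1) (hM : 1 ≤ M)
    (h11 : μ ≤ -A11)
    (hell : μ / 2 * (b ^ 2 + c ^ 2) ≤ A22 * b ^ 2 + 2 * A23 * b * c + A33 * c ^ 2)
    (hr11 : |r11| ≤ M) (hr22 : |r22| ≤ M) (hr23 : |r23| ≤ M) (hr33 : |r33| ≤ M)
    (ht12 : |t12| ≤ M) (ht22 : |t22| ≤ M) (ht23 : |t23| ≤ M)
    (hz13 : |z13| ≤ M) (hz33 : |z33| ≤ M) (hz23 : |z23| ≤ M)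
    (ha1 : |a1| ≤ M) (hU : |U| ≤ M) (hb2 : |b2| ≤ M) (ha2 : |a2| ≤ M) (hb3 : |b3| ≤ M)
    (hir : |ir| ≤ M) (hir2 : κ ≤ ir2)
    (hw0 : 0 ≤ w) (hwT : w ≤ T) (hd0 : 0 ≤ d) (hdT : d ≤ T)
    (hT1 : T ≤ 1) (hTM : 160 * M * T ≤ μ) (hlam : lam = 8 * M ^ 2 / μ + 2 * M ^ 2 + 2 * M + 6)
    (hTlam : 8 * lam * T ≤ 1) (hc0 : c0 ≤ μ / 16) (hc0κ : c0 ≤ κ) :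
    c0 * (s ^ 2 + a ^ 2 + b ^ 2 + c ^ 2 + φ ^ 2 + x ^ 2 + y ^ 2 + u ^ 2) - (F3 ^ 2 + F4 ^ 2) ≤
      1 / 2 * (-A11 * a ^ 2 + A22 * b ^ 2 + 2 * A23 * b * c + A33 * c ^ 2)
      + w * (a * (F3 - a1 * a - U * x - b2 * φ)
        - (1 / 2 * (-(r11 * (a * a)) + r22 * (b * b) + 2 * (r23 * (b * c)) + r33 * (c * c))
          - (t12 * (a * a) + t22 * (a * b) + t23 * (a * c))
          - (z13 * (a * a) + z33 * (a * c) + z23 * (a * b))))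
      + (x ^ 2 + ir2 * y ^ 2 + u ^ 2) + φ * (F4 - ir * x - a2 * a + b3 * φ)
      + lam * (φ ^ 2 + 2 * d * (φ * x)) + (s ^ 2 - 2 * w * (s * a)) := by
  have hT0 : 0 ≤ T := hw0.trans hwT
  have hM0 : 0 < M := by linarith
  have e1 := abs_le.1 (abs_mul_mul_le_half hr11 a a)
  have e2 := abs_le.1 (abs_mul_mul_le_half hr22 b b)
  have e3 := abs_le.1 (abs_mul_mul_le_half hr23 b c)
  have e4 := abs_le.1 (abs_mul_mul_le_half hr33 c c)
  have e5 := abs_le.1 (abs_mul_mul_le_half ht12 a a)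
  have e6 := abs_le.1 (abs_mul_mul_le_half ht22 a b)
  have e7 := abs_le.1 (abs_mul_mul_le_half ht23 a c)
  have e8 := abs_le.1 (abs_mul_mul_le_half hz13 a a)
  have e9 := abs_le.1 (abs_mul_mul_le_half hz33 a c)
  have e10 := abs_le.1 (abs_mul_mul_le_half hz23 a b)
  have f1 := abs_le.1 (abs_mul_mul_le_half ha1 a a)
  have f2 := abs_le.1 (abs_mul_mul_le_half hU a x)
  have f3 := abs_le.1 (abs_mul_mul_le_half hb2 a φ)
  have hNnn : 0 ≤ a ^ 2 + b ^ 2 + c ^ 2 := by positivity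
  have f4 : -(M * a ^ 2 + F3 ^ 2) ≤ a * F3 := by
    have := mul_le_mul_of_nonneg_right hM (sq_nonneg a)
    nlinarith only [this, sq_nonneg (a + F3), sq_nonneg F3, sq_nonneg a]
  have hX : -(10 * M * (a ^ 2 + b ^ 2 + c ^ 2) + M * x ^ 2 + M * φ ^ 2 + F3 ^ 2) ≤
      a * (F3 - a1 * a - U * x - b2 * φ)
        - (1 / 2 * (-(r11 * (a * a)) + r22 * (b * b) + 2 * (r23 * (b * c)) + r33 * (c * c))
          - (t12 * (a * a) + t22 * (a * b) + t23 * (a * c))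
          - (z13 * (a * a) + z33 * (a * c) + z23 * (a * b))) := by
    have pa : 0 ≤ M * a ^ 2 := by positivity
    have pb : 0 ≤ M * b ^ 2 := by positivity
    have pc : 0 ≤ M * c ^ 2 := by positivity
    have px : 0 ≤ M * x ^ 2 := by positivity
    have pφ : 0 ≤ M * φ ^ 2 := by positivity
    have lot : 1 / 2 * (-(r11 * (a * a)) + r22 * (b * b) + 2 * (r23 * (b * c)) + r33 * (c * c)) ≤
        M / 2 * (a ^ 2 + 2 * b ^ 2 + 2 * c ^ 2) := by
      linarith only [e1.1, e2.2, e3.2, e4.2, pa, pb, pc]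
    have lot' : -(t12 * (a * a) + t22 * (a * b) + t23 * (a * c))
        - (z13 * (a * a) + z33 * (a * c) + z23 * (a * b)) ≤
        M / 2 * (8 * a ^ 2 + 2 * b ^ 2 + 2 * c ^ 2) := by
      linarith only [e5.1, e6.1, e7.1, e8.1, e9.1, e10.1, pa, pb, pc]
    linarith only [lot, lot', f1.2, f2.2, f3.2, f4, pa, pb, pc, px, pφ]
  have hTM' : M * T ≤ 1 / 160 := by nlinarith only [hTM, hμ1]
  have hwX : -(μ / 16 * (a ^ 2 + b ^ 2 + c ^ 2) + 1 / 160 * x ^ 2 + 1 / 160 * φ ^ 2 + F3 ^ 2) ≤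
      w * (a * (F3 - a1 * a - U * x - b2 * φ)
        - (1 / 2 * (-(r11 * (a * a)) + r22 * (b * b) + 2 * (r23 * (b * c)) + r33 * (c * c))
          - (t12 * (a * a) + t22 * (a * b) + t23 * (a * c))
          - (z13 * (a * a) + z33 * (a * c) + z23 * (a * b)))) := by
    refine le_trans ?_ (mul_le_mul_of_nonneg_left hX hw0)
    have q0 : 0 ≤ 10 * M * (a ^ 2 + b ^ 2 + c ^ 2) + M * x ^ 2 + M * φ ^ 2 + F3 ^ 2 := by
      positivity
    have q1 := mul_le_mul_of_nonneg_right hwT q0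
    have q2 : M * T * x ^ 2 ≤ 1 / 160 * x ^ 2 := mul_le_mul_of_nonneg_right hTM' (sq_nonneg _)
    have q3 : M * T * φ ^ 2 ≤ 1 / 160 * φ ^ 2 := mul_le_mul_of_nonneg_right hTM' (sq_nonneg _)
    have q4 : 160 * M * T * (a ^ 2 + b ^ 2 + c ^ 2) ≤ μ * (a ^ 2 + b ^ 2 + c ^ 2) :=
      mul_le_mul_of_nonneg_right hTM hNnn
    have q5 : T * F3 ^ 2 ≤ 1 * F3 ^ 2 := mul_le_mul_of_nonneg_right hT1 (sq_nonneg _)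
    linarith only [q1, q2, q3, q4, q5]
  have hA : μ * a ^ 2 ≤ -A11 * a ^ 2 := mul_le_mul_of_nonneg_right h11 (sq_nonneg _)
  have g1 : -(φ ^ 2 + F4 ^ 2) ≤ φ * F4 := by
    nlinarith only [sq_nonneg (φ + F4), sq_nonneg φ, sq_nonneg F4]
  have hirsq : ir ^ 2 ≤ M ^ 2 := sq_le_sq' (abs_le.1 hir).1 (abs_le.1 hir).2
  have ha2sq : a2 ^ 2 ≤ M ^ 2 := sq_le_sq' (abs_le.1 ha2).1 (abs_le.1 ha2).2
  have g2 : φ * (ir * x) ≤ M ^ 2 * φ ^ 2 + x ^ 2 / 4 := by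
    nlinarith only [sq_nonneg (ir * φ - x / 2), mul_le_mul_of_nonneg_right hirsq (sq_nonneg φ)]
  have g3 : φ * (a2 * a) ≤ 4 * M ^ 2 / μ * φ ^ 2 + μ / 16 * a ^ 2 := by
    have k1 : φ * (a2 * a) ≤ 4 / μ * (a2 ^ 2 * φ ^ 2) + μ / 16 * a ^ 2 := by
      have k2 : 4 / μ * (a2 ^ 2 * φ ^ 2) + μ / 16 * a ^ 2 - φ * (a2 * a) =
          4 / μ * (a2 * φ - μ / 8 * a) ^ 2 := by
        field_simp
        ring
      have k3 : 0 ≤ 4 / μ * (a2 * φ - μ / 8 * a) ^ 2 := by positivity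
      linarith
    have k4 : 4 / μ * (a2 ^ 2 * φ ^ 2) ≤ 4 / μ * (M ^ 2 * φ ^ 2) := by gcongr
    have k5 : 4 / μ * (M ^ 2 * φ ^ 2) = 4 * M ^ 2 / μ * φ ^ 2 := by ring
    linarith
  have g4 : -(M * φ ^ 2) ≤ b3 * φ ^ 2 := by
    have := mul_le_mul_of_nonneg_right (abs_le.1 hb3).1 (sq_nonneg φ)
    linarith
  have hlam0 : 0 ≤ lam := by rw [hlam]; positivity
  have hd2 : d ^ 2 ≤ T := by nlinarith only [hd0, hdT, hT1, hT0]
  have hw2 : w ^ 2 ≤ T := by nlinarith only [hw0, hwT, hT1, hT0]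
  have g5 : lam / 2 * φ ^ 2 - 1 / 4 * x ^ 2 ≤ lam * (φ ^ 2 + 2 * d * (φ * x)) := by
    have k1 : 1 / 2 * φ ^ 2 - 2 * T * x ^ 2 ≤ φ ^ 2 + 2 * d * (φ * x) := by
      nlinarith only [sq_nonneg (φ + 2 * d * x), mul_le_mul_of_nonneg_right hd2 (sq_nonneg x)]
    have k2 := mul_le_mul_of_nonneg_left k1 hlam0
    have k3 := mul_le_mul_of_nonneg_right hTlam (sq_nonneg x)
    linarith
  have g6 : 1 / 2 * s ^ 2 - μ / 80 * a ^ 2 ≤ s ^ 2 - 2 * w * (s * a) := by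
    have k1 : 2 * T ≤ μ / 80 := by nlinarith only [hTM, mul_le_mul_of_nonneg_right hM hT0]
    nlinarith only [sq_nonneg (s - 2 * w * a), mul_le_mul_of_nonneg_right hw2 (sq_nonneg a),
      mul_le_mul_of_nonneg_right k1 (sq_nonneg a)]
  have g7 : κ * y ^ 2 ≤ ir2 * y ^ 2 := mul_le_mul_of_nonneg_right hir2 (sq_nonneg _)
  have g8 : lam / 2 * φ ^ 2 =
      4 * M ^ 2 / μ * φ ^ 2 + M ^ 2 * φ ^ 2 + M * φ ^ 2 + 3 * φ ^ 2 := by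
    rw [hlam]; ring
  have c1 := mul_le_mul_of_nonneg_right hc0 hNnn
  have c2 : c0 * (s ^ 2 + φ ^ 2 + x ^ 2 + u ^ 2) ≤ 1 / 16 * (s ^ 2 + φ ^ 2 + x ^ 2 + u ^ 2) :=
    mul_le_mul_of_nonneg_right (by linarith) (by positivity)
  have c3 := mul_le_mul_of_nonneg_right hc0κ (sq_nonneg y)
  have pa : 0 ≤ μ * a ^ 2 := by positivity
  have pb : 0 ≤ μ * b ^ 2 := by positivity
  have pc : 0 ≤ μ * c ^ 2 := by positivity
  linarith only [hwX, hA, hell, g1, g2, g3, g4, g5, g6, g7, g8, c1, c2, c3, pa, pb, pc,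
    sq_nonneg s, sq_nonneg φ, sq_nonneg x, sq_nonneg u]

/-- `f` is differentiable within `S` at `p`, with directional derivative `d` along `v`. -/
def HasPdvAt (S : Set (ℝ × ℝ × ℝ)) (v : ℝ × ℝ × ℝ) (f : ℝ × ℝ × ℝ → ℝ) (d : ℝ)
    (p : ℝ × ℝ × ℝ) : Prop :=
  ∃ f' : ℝ × ℝ × ℝ →L[ℝ] ℝ, HasFDerivWithinAt f f' S p ∧ f' v = d

namespace HasPdvAt

variable {S : Set (ℝ × ℝ × ℝ)} {v : ℝ × ℝ × ℝ} {f g : ℝ × ℝ × ℝ → ℝ} {d e : ℝ} {p : ℝ × ℝ × ℝ}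

lemma add (hf : HasPdvAt S v f d p) (hg : HasPdvAt S v g e p) :
    HasPdvAt S v (fun q => f q + g q) (d + e) p := by
  obtain ⟨f', hf, rfl⟩ := hf
  obtain ⟨g', hg, rfl⟩ := hg
  exact ⟨_, hf.add hg, rfl⟩

lemma mul (hf : HasPdvAt S v f d p) (hg : HasPdvAt S v g e p) :
    HasPdvAt S v (fun q => f q * g q) (d * g p + f p * e) p := by
  obtain ⟨f', hf, rfl⟩ := hf
  obtain ⟨g', hg, rfl⟩ := hg
  refine ⟨_, hf.mul hg, ?_⟩
  simp
  ring

lemma const_mul (k : ℝ) (hf : HasPdvAt S v f d p) :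
    HasPdvAt S v (fun q => k * f q) (k * d) p := by
  obtain ⟨f', hf, rfl⟩ := hf
  exact ⟨_, hf.const_mul k, by simp⟩

lemma comp_fst {h : ℝ → ℝ} {h' : ℝ} {I : Set ℝ} (hh : HasDerivWithinAt h h' I p.1)
    (hI : ∀ q ∈ S, q.1 ∈ I) : HasPdvAt S v (fun q => h q.1) (v.1 * h') p :=
  ⟨_, hh.hasFDerivWithinAt.comp p (hasFDerivWithinAt_fst) hI, by simp⟩

lemma pdv_eq (hf : HasPdvAt S v f d p) (hS : UniqueDiffWithinAt ℝ S p) : pdv S v f p = d := by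
  obtain ⟨f', hf, rfl⟩ := hf
  rw [pdv, hf.fderivWithin hS]

end HasPdvAt

lemma hasPdvAt_pdv {S : Set (ℝ × ℝ × ℝ)} {f : ℝ × ℝ × ℝ → ℝ} (hf : ContDiffOn ℝ 1 f S)
    (v : ℝ × ℝ × ℝ) {p : ℝ × ℝ × ℝ} (hp : p ∈ S) : HasPdvAt S v f (pdv S v f p) p :=
  ⟨_, (hf.differentiableOn (by simp) p hp).hasFDerivWithinAt, rfl⟩

lemma abs_pdv_le {S : Set (ℝ × ℝ × ℝ)} (f : ℝ × ℝ × ℝ → ℝ) {v : ℝ × ℝ × ℝ} (hv : ‖v‖ ≤ 1)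
    (p : ℝ × ℝ × ℝ) : |pdv S v f p| ≤ ‖fderivWithin ℝ f S p‖ := by
  have h := (fderivWithin ℝ f S p).le_opNorm v
  exact h.trans (mul_le_of_le_one_right (norm_nonneg _) hv)

lemma abs_pdv_le_of_sub_comp_fst {S : Set (ℝ × ℝ × ℝ)} {f : ℝ × ℝ × ℝ → ℝ}
    (hf : ContDiffOn ℝ 1 f S) {v : ℝ × ℝ × ℝ} (hv : ‖v‖ ≤ 1) {p : ℝ × ℝ × ℝ} (hp : p ∈ S)
    (hS : UniqueDiffWithinAt ℝ S p) {h : ℝ → ℝ} {h' δ M : ℝ} {I : Set ℝ}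
    (hh : HasDerivWithinAt h h' I p.1) (hI : ∀ q ∈ S, q.1 ∈ I) (hM : |h'| ≤ M)
    (hδ : ‖fderivWithin ℝ (fun q : ℝ × ℝ × ℝ => f q - h q.1) S p‖ ≤ δ) :
    |pdv S v f p| ≤ δ + M := by
  have h1 : HasPdvAt S v (fun q => f q + (-1) * h q.1) (pdv S v f p + (-1) * (v.1 * h')) p :=
    (hasPdvAt_pdv hf v hp).add ((HasPdvAt.comp_fst hh hI).const_mul (-1))
  have h2 : (fun q : ℝ × ℝ × ℝ => f q - h q.1) = fun q => f q + (-1) * h q.1 := by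
    funext q; ring
  rw [h2] at hδ
  have h3 := (abs_pdv_le (S := S) (fun q => f q + (-1) * h q.1) hv p).trans hδ
  rw [h1.pdv_eq hS] at h3
  have hv1 : |v.1| ≤ 1 := (norm_fst_le v).trans hv
  have h4 : |v.1 * h'| ≤ M := by
    rw [abs_mul]
    calc |v.1| * |h'| ≤ 1 * M := mul_le_mul hv1 hM (abs_nonneg _) zero_le_one
      _ = M := one_mul M
  calc |pdv S v f p| = |(pdv S v f p + (-1) * (v.1 * h')) + v.1 * h'| := by ring_nf
    _ ≤ |pdv S v f p + (-1) * (v.1 * h')| + |v.1 * h'| := abs_add_le _ _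
    _ ≤ δ + M := add_le_add h3 h4

lemma norm_er_le : ‖er‖ ≤ 1 := by simp [er, Prod.norm_def]
lemma norm_eθ_le : ‖eθ‖ ≤ 1 := by simp [eθ, Prod.norm_def]
lemma norm_ez_le : ‖ez‖ ≤ 1 := by simp [ez, Prod.norm_def]

/-- The divergence theorem on the box for a flux that vanishes at the exit and on the walls,
combined with a pointwise lower bound for the divergence. -/
lemma integral_le_of_le_divergence {r₀ r₁ θ₀ c0 B : ℝ} (hr : r₀ < r₁) (hθ : 0 < θ₀)
    {Gr Gθ Gz Q F : ℝ × ℝ × ℝ → ℝ} {F₅ : ℝ × ℝ → ℝ}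
    (hGr : ContDiffOn ℝ 1 Gr (closure (Cyl r₀ r₁ θ₀)))
    (hGθ : ContDiffOn ℝ 1 Gθ (closure (Cyl r₀ r₁ θ₀)))
    (hGz : ContDiffOn ℝ 1 Gz (closure (Cyl r₀ r₁ θ₀)))
    (hQ : ContinuousOn Q (closure (Cyl r₀ r₁ θ₀)))
    (hF : ContinuousOn F (closure (Cyl r₀ r₁ θ₀)))
    (hF₅ : ContinuousOn F₅ (closure (CrossD θ₀)))
    (hexit : ∀ q ∈ CrossD θ₀, Gr (r₁, q) = 0)
    (hentr : ∀ q ∈ CrossD θ₀, -Gr (r₀, q) ≤ B * F₅ q)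
    (hθ0 : ∀ p ∈ closure (Cyl r₀ r₁ θ₀), (p.2.1 = θ₀ ∨ p.2.1 = -θ₀) → Gθ p = 0)
    (hz0 : ∀ p ∈ closure (Cyl r₀ r₁ θ₀), (p.2.2 = 1 ∨ p.2.2 = -1) → Gz p = 0)
    (hdiv : ∀ p ∈ Cyl r₀ r₁ θ₀, c0 * Q p - F p ≤ pdv (closure (Cyl r₀ r₁ θ₀)) er Gr p
      + pdv (closure (Cyl r₀ r₁ θ₀)) eθ Gθ p + pdv (closure (Cyl r₀ r₁ θ₀)) ez Gz p) :
    c0 * ∫ p in Cyl r₀ r₁ θ₀, Q p ≤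
      (∫ p in Cyl r₀ r₁ θ₀, F p) + B * ∫ q in CrossD θ₀, F₅ q := by
  have hS := uniqueDiffOn_closure_Cyl hr hθ
  have ir := integrableOn_Cyl hr hθ (continuousOn_pdv hS er hGr)
  have iθ := integrableOn_Cyl hr hθ (continuousOn_pdv hS eθ hGθ)
  have iz := integrableOn_Cyl hr hθ (continuousOn_pdv hS ez hGz)
  have iQ := integrableOn_Cyl hr hθ hQ
  have iF := integrableOn_Cyl hr hθ hF
  have h1 := setIntegral_mono_on ((iQ.const_mul c0).sub iF) ((ir.add iθ).add iz)
    (isOpen_Cyl r₀ r₁ θ₀).measurableSet hdiv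
  rw [integral_sub' (iQ.const_mul c0) iF, integral_add' (ir.add iθ) iz, integral_add' ir iθ,
    integral_pdv_er hr hθ hGr, integral_pdv_eθ hr hθ hGθ hθ0, integral_pdv_ez hr hθ hGz hz0,
    integral_const_mul] at h1
  have hsl : ∀ r ∈ Icc r₀ r₁, IntegrableOn (fun q => Gr (r, q)) (CrossD θ₀) := by
    intro r hrr
    refine integrableOn_CrossD hθ (hGr.continuousOn.comp (by fun_prop) fun q hq => ?_)
    rw [closure_CrossD hθ] at hq
    rw [closure_Cyl hr hθ]
    exact ⟨hrr, hq⟩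
  have h2 : ∫ q in CrossD θ₀, (Gr (r₁, q) - Gr (r₀, q)) ≤ ∫ q in CrossD θ₀, B * F₅ q := by
    refine setIntegral_mono_on ((hsl r₁ ⟨hr.le, le_rfl⟩).sub (hsl r₀ ⟨le_rfl, hr.le⟩))
      ((integrableOn_CrossD hθ hF₅).const_mul B) (measurableSet_CrossD θ₀) fun q hq => ?_
    rw [hexit q hq, zero_sub]
    exact hentr q hq
  rw [integral_const_mul] at h2
  linarith

/-- Radial component of the energy flux. -/
noncomputable def fluxR (r₀ r₁ lam : ℝ) (A11 A22 A23 A33 ψ a b c Ψ x : ℝ × ℝ × ℝ → ℝ) :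
    ℝ × ℝ × ℝ → ℝ := fun q =>
  (-(1 / 2)) * ((r₁ - q.1) * ((-1) * (A11 q * (a q * a q)) + A22 q * (b q * b q)
    + 2 * (A23 q * (b q * c q)) + A33 q * (c q * c q)))
  + Ψ q * x q + lam * ((q.1 - r₀) * (Ψ q * Ψ q)) + (-1) * ((r₁ - q.1) * (ψ q * ψ q))

/-- Angular component of the energy flux. -/
noncomputable def fluxθ (r₁ : ℝ) (A12 A22 A23 a b c Ψ y : ℝ × ℝ × ℝ → ℝ) :
    ℝ × ℝ × ℝ → ℝ := fun q =>
  (r₁ - q.1) * (A12 q * (a q * a q) + A22 q * (a q * b q) + A23 q * (a q * c q))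
  + (1 / q.1 ^ 2) * (Ψ q * y q)

/-- Axial component of the energy flux. -/
noncomputable def fluxZ (r₁ : ℝ) (A13 A33 A23 a b c Ψ u : ℝ × ℝ × ℝ → ℝ) :
    ℝ × ℝ × ℝ → ℝ := fun q =>
  (r₁ - q.1) * (A13 q * (a q * a q) + A33 q * (a q * c q) + A23 q * (a q * b q)) + Ψ q * u q

section flux

variable {S : Set (ℝ × ℝ × ℝ)} {p : ℝ × ℝ × ℝ} {r₀ r₁ lam : ℝ}
  {A11 A12 A13 A22 A23 A33 ψ a b c Ψ x y u : ℝ × ℝ × ℝ → ℝ}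

lemma hasPdvAt_sub_fst (r₁ : ℝ) (v : ℝ × ℝ × ℝ) :
    HasPdvAt S v (fun q => r₁ - q.1) (v.1 * (-1)) p :=
  HasPdvAt.comp_fst (h := fun r => r₁ - r) (I := univ)
    (((hasDerivAt_id p.1).const_sub r₁).hasDerivWithinAt) fun _ _ => mem_univ _

lemma hasPdvAt_fst_sub (r₀ : ℝ) (v : ℝ × ℝ × ℝ) :
    HasPdvAt S v (fun q => q.1 - r₀) (v.1 * 1) p :=
  HasPdvAt.comp_fst (h := fun r => r - r₀) (I := univ)
    (((hasDerivAt_id p.1).sub_const r₀).hasDerivWithinAt) fun _ _ => mem_univ _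

lemma pdv_fluxR (hS : UniqueDiffWithinAt ℝ S p) (hp : p ∈ S)
    (h11 : ContDiffOn ℝ 1 A11 S) (h22 : ContDiffOn ℝ 1 A22 S) (h23 : ContDiffOn ℝ 1 A23 S)
    (h33 : ContDiffOn ℝ 1 A33 S) (hψ : ContDiffOn ℝ 1 ψ S) (ha : ContDiffOn ℝ 1 a S)
    (hb : ContDiffOn ℝ 1 b S) (hc : ContDiffOn ℝ 1 c S) (hΨ : ContDiffOn ℝ 1 Ψ S)
    (hx : ContDiffOn ℝ 1 x S) :
    pdv S er (fluxR r₀ r₁ lam A11 A22 A23 A33 ψ a b c Ψ x) p =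
      1 / 2 * (-A11 p * a p ^ 2 + A22 p * b p ^ 2 + 2 * A23 p * b p * c p + A33 p * c p ^ 2)
      - (r₁ - p.1) * (1 / 2 * (-(pdv S er A11 p * (a p * a p)) + pdv S er A22 p * (b p * b p)
          + 2 * (pdv S er A23 p * (b p * c p)) + pdv S er A33 p * (c p * c p))
        - A11 p * a p * pdv S er a p + A22 p * b p * pdv S er b p
        + A23 p * (pdv S er b p * c p + b p * pdv S er c p) + A33 p * c p * pdv S er c p)
      + (pdv S er Ψ p * x p + Ψ p * pdv S er x p)
      + lam * (Ψ p ^ 2 + 2 * (p.1 - r₀) * (Ψ p * pdv S er Ψ p))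
      + (ψ p ^ 2 - 2 * (r₁ - p.1) * (ψ p * pdv S er ψ p)) := by
  have k11 := hasPdvAt_pdv h11 er hp
  have k22 := hasPdvAt_pdv h22 er hp
  have k23 := hasPdvAt_pdv h23 er hp
  have k33 := hasPdvAt_pdv h33 er hp
  have ka := hasPdvAt_pdv ha er hp
  have kb := hasPdvAt_pdv hb er hp
  have kc := hasPdvAt_pdv hc er hp
  have kψ := hasPdvAt_pdv hψ er hp
  have kΨ := hasPdvAt_pdv hΨ er hp
  have kx := hasPdvAt_pdv hx er hp
  have hw := hasPdvAt_sub_fst (S := S) (p := p) r₁ er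
  have hd := hasPdvAt_fst_sub (S := S) (p := p) r₀ er
  have h := (((((hw.mul (((((k11.mul (ka.mul ka)).const_mul (-1)).add
    (k22.mul (kb.mul kb))).add ((k23.mul (kb.mul kc)).const_mul 2)).add
    (k33.mul (kc.mul kc)))).const_mul (-(1 / 2))).add (kΨ.mul kx)).add
    ((hd.mul (kΨ.mul kΨ)).const_mul lam)).add ((hw.mul (kψ.mul kψ)).const_mul (-1)))
  refine (h.pdv_eq hS).trans ?_
  simp only [er]
  ring

lemma pdv_fluxθ (hS : UniqueDiffWithinAt ℝ S p) (hp : p ∈ S) (hp0 : p.1 ≠ 0)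
    (h12 : ContDiffOn ℝ 1 A12 S) (h22 : ContDiffOn ℝ 1 A22 S) (h23 : ContDiffOn ℝ 1 A23 S)
    (ha : ContDiffOn ℝ 1 a S) (hb : ContDiffOn ℝ 1 b S) (hc : ContDiffOn ℝ 1 c S)
    (hΨ : ContDiffOn ℝ 1 Ψ S) (hy : ContDiffOn ℝ 1 y S) :
    pdv S eθ (fluxθ r₁ A12 A22 A23 a b c Ψ y) p =
      (r₁ - p.1) * (pdv S eθ A12 p * (a p * a p) + pdv S eθ A22 p * (a p * b p)
          + pdv S eθ A23 p * (a p * c p)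
        + 2 * A12 p * a p * pdv S eθ a p + A22 p * (pdv S eθ a p * b p + a p * pdv S eθ b p)
        + A23 p * (pdv S eθ a p * c p + a p * pdv S eθ c p))
      + 1 / p.1 ^ 2 * (pdv S eθ Ψ p * y p + Ψ p * pdv S eθ y p) := by
  have k12 := hasPdvAt_pdv h12 eθ hp
  have k22 := hasPdvAt_pdv h22 eθ hp
  have k23 := hasPdvAt_pdv h23 eθ hp
  have ka := hasPdvAt_pdv ha eθ hp
  have kb := hasPdvAt_pdv hb eθ hp
  have kc := hasPdvAt_pdv hc eθ hp
  have kΨ := hasPdvAt_pdv hΨ eθ hp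
  have ky := hasPdvAt_pdv hy eθ hp
  have hw := hasPdvAt_sub_fst (S := S) (p := p) r₁ eθ
  have hd : DifferentiableAt ℝ (fun r : ℝ => 1 / r ^ 2) p.1 := by
    refine DifferentiableAt.div (by fun_prop) (by fun_prop) (pow_ne_zero 2 hp0)
  have hi : HasPdvAt S eθ (fun q => 1 / q.1 ^ 2) _ p :=
    HasPdvAt.comp_fst (h := fun r : ℝ => 1 / r ^ 2) (I := univ)
      hd.hasDerivAt.hasDerivWithinAt fun _ _ => mem_univ _
  have h := (hw.mul (((k12.mul (ka.mul ka)).add (k22.mul (ka.mul kb))).add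
    (k23.mul (ka.mul kc)))).add (hi.mul (kΨ.mul ky))
  refine (h.pdv_eq hS).trans ?_
  simp only [eθ]
  ring

lemma pdv_fluxZ (hS : UniqueDiffWithinAt ℝ S p) (hp : p ∈ S)
    (h13 : ContDiffOn ℝ 1 A13 S) (h33 : ContDiffOn ℝ 1 A33 S) (h23 : ContDiffOn ℝ 1 A23 S)
    (ha : ContDiffOn ℝ 1 a S) (hb : ContDiffOn ℝ 1 b S) (hc : ContDiffOn ℝ 1 c S)
    (hΨ : ContDiffOn ℝ 1 Ψ S) (hu : ContDiffOn ℝ 1 u S) :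
    pdv S ez (fluxZ r₁ A13 A33 A23 a b c Ψ u) p =
      (r₁ - p.1) * (pdv S ez A13 p * (a p * a p) + pdv S ez A33 p * (a p * c p)
          + pdv S ez A23 p * (a p * b p)
        + 2 * A13 p * a p * pdv S ez a p + A33 p * (pdv S ez a p * c p + a p * pdv S ez c p)
        + A23 p * (pdv S ez a p * b p + a p * pdv S ez b p))
      + (pdv S ez Ψ p * u p + Ψ p * pdv S ez u p) := by
  have k13 := hasPdvAt_pdv h13 ez hp
  have k33 := hasPdvAt_pdv h33 ez hp
  have k23 := hasPdvAt_pdv h23 ez hp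
  have ka := hasPdvAt_pdv ha ez hp
  have kb := hasPdvAt_pdv hb ez hp
  have kc := hasPdvAt_pdv hc ez hp
  have kΨ := hasPdvAt_pdv hΨ ez hp
  have ku := hasPdvAt_pdv hu ez hp
  have hw := hasPdvAt_sub_fst (S := S) (p := p) r₁ ez
  have h := (hw.mul (((k13.mul (ka.mul ka)).add (k33.mul (ka.mul kc))).add
    (k23.mul (ka.mul kb)))).add (kΨ.mul ku)
  refine (h.pdv_eq hS).trans ?_
  simp only [ez]
  ring

end flux

lemma pdv_eq_zero_of_eventually {S : Set (ℝ × ℝ × ℝ)} {f : ℝ × ℝ × ℝ → ℝ}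
    (hf : ContDiffOn ℝ 1 f S) (l : ℝ → ℝ × ℝ × ℝ) (v : ℝ × ℝ × ℝ) {t : ℝ} {I : Set ℝ}
    (hl : HasDerivAt l v t) (hI : IsOpen I) (ht : t ∈ I) (hm : ∀ τ ∈ I, l τ ∈ S)
    (h0 : ∀ τ ∈ I, f (l τ) = 0) : pdv S v f (l t) = 0 := by
  have h1 : HasDerivWithinAt (fun τ => f (l τ)) (pdv S v f (l t)) I t :=
    ((hf.differentiableOn (by simp) (l t) (hm t ht)).hasFDerivWithinAt).comp_hasDerivWithinAt t
      hl.hasDerivWithinAt hm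
  have h2 : HasDerivWithinAt (fun τ => f (l τ)) 0 I t :=
    (hasDerivWithinAt_const t I (0 : ℝ)).congr h0 (h0 t ht)
  exact (hI.uniqueDiffWithinAt ht).eq_deriv _ h1 h2

/-- The `H¹` energy estimate on a sufficiently thin box, for a hyperbolic–elliptic coupled system
whose coefficients satisfy explicit bounds. -/
lemma energy_estimate {r₀ r₁ θ₀ M μ κ lam c0 : ℝ} (hr₀ : 0 < r₀) (hr : r₀ < r₁) (hθ : 0 < θ₀)
    (hμ : 0 < μ) (hμ1 : μ < 1) (hM : 1 ≤ M)
    (hT1 : r₁ - r₀ ≤ 1) (hTM : 160 * M * (r₁ - r₀) ≤ μ)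
    (hlam : lam = 8 * M ^ 2 / μ + 2 * M ^ 2 + 2 * M + 6) (hTlam : 8 * lam * (r₁ - r₀) ≤ 1)
    (hc0 : c0 ≤ μ / 16) (hc0κ : c0 ≤ κ)
    (hκ : ∀ r ∈ Ioo r₀ r₁, κ ≤ 1 / r ^ 2) (hir : ∀ r ∈ Ioo r₀ r₁, |1 / r| ≤ M)
    {a1 U b2 a2 b3 : ℝ → ℝ}
    (ha1 : ∀ r ∈ Ioo r₀ r₁, |a1 r| ≤ M) (hU : ∀ r ∈ Ioo r₀ r₁, |U r| ≤ M)
    (hb2 : ∀ r ∈ Ioo r₀ r₁, |b2 r| ≤ M) (ha2 : ∀ r ∈ Ioo r₀ r₁, |a2 r| ≤ M)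
    (hb3 : ∀ r ∈ Ioo r₀ r₁, |b3 r| ≤ M)
    {K : Set (ℝ × ℝ × ℝ)} (hK : K = closure (Cyl r₀ r₁ θ₀))
    {A11 A12 A13 A22 A23 A33 : ℝ × ℝ × ℝ → ℝ}
    (h11 : ContDiffOn ℝ 1 A11 K) (h12 : ContDiffOn ℝ 1 A12 K) (h13 : ContDiffOn ℝ 1 A13 K)
    (h22 : ContDiffOn ℝ 1 A22 K) (h23 : ContDiffOn ℝ 1 A23 K) (h33 : ContDiffOn ℝ 1 A33 K)
    (hA11 : ∀ p ∈ K, μ ≤ -A11 p ∧ -A11 p ≤ 1 / μ)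
    (hell : ∀ p ∈ K, ∀ ξ₂ ξ₃ : ℝ, μ / 2 * (ξ₂ ^ 2 + ξ₃ ^ 2)
      ≤ A22 p * ξ₂ ^ 2 + 2 * A23 p * ξ₂ * ξ₃ + A33 p * ξ₃ ^ 2)
    (hwθ : ∀ p ∈ K, (p.2.1 = θ₀ ∨ p.2.1 = -θ₀) → A12 p = 0 ∧ A23 p = 0)
    (hwz : ∀ p ∈ K, (p.2.2 = 1 ∨ p.2.2 = -1) → A13 p = 0 ∧ A23 p = 0)
    (hD : ∀ v, ‖v‖ ≤ 1 → ∀ p ∈ K, |pdv K v A11 p| ≤ M ∧ |pdv K v A22 p| ≤ M ∧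
      |pdv K v A33 p| ≤ M ∧ |pdv K v A12 p| ≤ M ∧ |pdv K v A13 p| ≤ M ∧ |pdv K v A23 p| ≤ M)
    {ψ Ψ F₃ F₄ : ℝ × ℝ × ℝ → ℝ} {F₅ : ℝ × ℝ → ℝ}
    (hψ : ContDiffOn ℝ 2 ψ K) (hΨ : ContDiffOn ℝ 2 Ψ K)
    (hF₃ : ContinuousOn F₃ K) (hF₄ : ContinuousOn F₄ K)
    (hF₅ : ContinuousOn F₅ (closure (CrossD θ₀)))
    (heq1 : ∀ p ∈ Cyl r₀ r₁ θ₀, A11 p * pdv K er (pdv K er ψ) p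
      + 2 * A12 p * pdv K eθ (pdv K er ψ) p + 2 * A13 p * pdv K ez (pdv K er ψ) p
      + A22 p * pdv K eθ (pdv K eθ ψ) p + 2 * A23 p * pdv K ez (pdv K eθ ψ) p
      + A33 p * pdv K ez (pdv K ez ψ) p + a1 p.1 * pdv K er ψ p + U p.1 * pdv K er Ψ p
      + b2 p.1 * Ψ p = F₃ p)
    (heq2 : ∀ p ∈ Cyl r₀ r₁ θ₀, pdv K er (pdv K er Ψ) p + (1 / p.1) * pdv K er Ψ p
      + (1 / p.1 ^ 2) * pdv K eθ (pdv K eθ Ψ) p + pdv K ez (pdv K ez Ψ) p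
      + a2 p.1 * pdv K er ψ p - b3 p.1 * Ψ p = F₄ p)
    (hbr : ∀ q ∈ Icc (-θ₀) θ₀ ×ˢ Icc (-1 : ℝ) 1, ψ (r₀, q.1, q.2) = 0 ∧
      pdv K er ψ (r₀, q.1, q.2) = F₅ q ∧ pdv K er Ψ (r₀, q.1, q.2) = 0 ∧
      Ψ (r₁, q.1, q.2) = 0)
    (hbθ : ∀ p ∈ K, (p.2.1 = θ₀ ∨ p.2.1 = -θ₀) → pdv K eθ ψ p = 0 ∧ pdv K eθ Ψ p = 0)
    (hbz : ∀ p ∈ K, (p.2.2 = 1 ∨ p.2.2 = -1) → pdv K ez ψ p = 0 ∧ pdv K ez Ψ p = 0) :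
    c0 * (∫ p in Cyl r₀ r₁ θ₀, ((ψ p) ^ 2 + (pdv K er ψ p) ^ 2 + (pdv K eθ ψ p) ^ 2
        + (pdv K ez ψ p) ^ 2 + (Ψ p) ^ 2 + (pdv K er Ψ p) ^ 2 + (pdv K eθ Ψ p) ^ 2
        + (pdv K ez Ψ p) ^ 2))
      ≤ (∫ p in Cyl r₀ r₁ θ₀, ((F₃ p) ^ 2 + (F₄ p) ^ 2))
        + 1 / μ * ∫ q in CrossD θ₀, (F₅ q) ^ 2 := by
  subst hK
  have hS := uniqueDiffOn_closure_Cyl hr hθ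
  have hKeq := closure_Cyl hr hθ
  set K := closure (Cyl r₀ r₁ θ₀)
  have hψ1 : ContDiffOn ℝ 1 ψ K := hψ.of_le (by norm_num)
  have hΨ1 : ContDiffOn ℝ 1 Ψ K := hΨ.of_le (by norm_num)
  have hd : ∀ {f : ℝ × ℝ × ℝ → ℝ} (v), ContDiffOn ℝ 2 f K → ContDiffOn ℝ 1 (pdv K v f) K :=
    fun v hf => contDiffOn_pdv hS v hf (by norm_num)
  have ha := hd er hψ
  have hb := hd eθ hψ
  have hc := hd ez hψ
  have hx := hd er hΨ
  have hy := hd eθ hΨ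
  have hu := hd ez hΨ
  have hpos : ∀ p ∈ K, 0 < p.1 := by
    intro p hp
    rw [hKeq] at hp
    exact hr₀.trans_le hp.1.1
  have hinv : ContDiffOn ℝ 1 (fun q : ℝ × ℝ × ℝ => 1 / q.1 ^ 2) K :=
    ContDiffOn.div (by fun_prop) (by fun_prop) fun q hq => pow_ne_zero 2 (hpos q hq).ne'
  refine integral_le_of_le_divergence hr hθ
    (Gr := fluxR r₀ r₁ lam A11 A22 A23 A33 ψ (pdv K er ψ) (pdv K eθ ψ) (pdv K ez ψ) Ψ
      (pdv K er Ψ))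
    (Gθ := fluxθ r₁ A12 A22 A23 (pdv K er ψ) (pdv K eθ ψ) (pdv K ez ψ) Ψ (pdv K eθ Ψ))
    (Gz := fluxZ r₁ A13 A33 A23 (pdv K er ψ) (pdv K eθ ψ) (pdv K ez ψ) Ψ (pdv K ez Ψ))
    (F₅ := fun q => F₅ q ^ 2)
    (by unfold fluxR; fun_prop) (by unfold fluxθ; fun_prop) (by unfold fluxZ; fun_prop)
    ?_ (by fun_prop) (hF₅.pow 2) ?_ ?_ ?_ ?_ ?_
  · have c1 := hψ.continuousOn
    have c2 := hΨ.continuousOn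
    have c3 := ha.continuousOn
    have c4 := hb.continuousOn
    have c5 := hc.continuousOn
    have c6 := hx.continuousOn
    have c7 := hy.continuousOn
    have c8 := hu.continuousOn
    fun_prop
  · intro q hq
    obtain ⟨-, -, -, h⟩ := hbr q ⟨Ioo_subset_Icc_self hq.1, Ioo_subset_Icc_self hq.2⟩
    simp only [Prod.mk.eta] at h
    simp [fluxR, h]
  · intro q hq
    have hq' : q ∈ Icc (-θ₀) θ₀ ×ˢ Icc (-1 : ℝ) 1 :=
      ⟨Ioo_subset_Icc_self hq.1, Ioo_subset_Icc_self hq.2⟩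
    have hmem : ∀ q ∈ Icc (-θ₀) θ₀ ×ˢ Icc (-1 : ℝ) 1, (r₀, q) ∈ K := by
      intro q hq
      rw [hKeq]
      exact ⟨⟨le_rfl, hr.le⟩, hq⟩
    obtain ⟨h1, h2, h3, -⟩ := hbr q hq'
    have hbz0 : pdv K eθ ψ (r₀, q.1, q.2) = 0 :=
      pdv_eq_zero_of_eventually hψ1 (fun t => (r₀, t, q.2)) eθ
        ((hasDerivAt_const q.1 r₀).prodMk ((hasDerivAt_id q.1).prodMk (hasDerivAt_const q.1 q.2)))
        isOpen_Ioo hq.1 (fun t ht => hmem (t, q.2) ⟨Ioo_subset_Icc_self ht, hq'.2⟩)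
        fun t ht => (hbr (t, q.2) ⟨Ioo_subset_Icc_self ht, hq'.2⟩).1
    have hcz0 : pdv K ez ψ (r₀, q.1, q.2) = 0 :=
      pdv_eq_zero_of_eventually hψ1 (fun t => (r₀, q.1, t)) ez
        ((hasDerivAt_const q.2 r₀).prodMk ((hasDerivAt_const q.2 q.1).prodMk (hasDerivAt_id q.2)))
        isOpen_Ioo hq.2 (fun t ht => hmem (q.1, t) ⟨hq'.1, Ioo_subset_Icc_self ht⟩)
        fun t ht => (hbr (q.1, t) ⟨hq'.1, Ioo_subset_Icc_self ht⟩).1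
    simp only [Prod.mk.eta] at h1 h2 h3 hbz0 hcz0
    have hA := hA11 (r₀, q) (hmem q hq')
    simp only [fluxR, h1, h2, h3, hbz0, hcz0]
    have k1 : (r₁ - r₀) * (-A11 (r₀, q)) ≤ 1 * (1 / μ) :=
      mul_le_mul hT1 hA.2 (by linarith [hA.1]) zero_le_one
    have k2 := mul_le_mul_of_nonneg_right k1 (sq_nonneg (F₅ q))
    have k3 : 0 ≤ 1 / μ * F₅ q ^ 2 := by positivity
    linarith only [k2, k3]
  · intro p hp h
    simp [fluxθ, hwθ p hp h, hbθ p hp h]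
  · intro p hp h
    simp [fluxZ, hwz p hp h, hbz p hp h]
  · intro p hp
    have hpK : p ∈ K := subset_closure hp
    obtain ⟨d11, d22, d33, d12, d13, d23⟩ := hD er norm_er_le p hpK
    obtain ⟨t11, t22, t33, t12, t13, t23⟩ := hD eθ norm_eθ_le p hpK
    obtain ⟨z11, z22, z33, z12, z13, z23⟩ := hD ez norm_ez_le p hpK
    have hpr : p.1 ∈ Ioo r₀ r₁ := hp.1
    rw [pdv_fluxR (hS p hpK) hpK h11 h22 h23 h33 hψ1 ha hb hc hΨ1 hx,
      pdv_fluxθ (hS p hpK) hpK (hpos p hpK).ne' h12 h22 h23 ha hb hc hΨ1 hy,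
      pdv_fluxZ (hS p hpK) hpK h13 h33 h23 ha hb hc hΨ1 hu]
    refine (energy_density_le (F3 := F₃ p) (F4 := F₄ p) (w := r₁ - p.1) (d := p.1 - r₀)
      hμ hμ1 hM (hA11 p hpK).1 (hell p hpK (pdv K eθ ψ p) (pdv K ez ψ p))
      d11 d22 d23 d33 t12 t22 t23 z13 z33 z23 (ha1 p.1 hpr) (hU p.1 hpr) (hb2 p.1 hpr)
      (ha2 p.1 hpr) (hb3 p.1 hpr) (hir p.1 hpr) (hκ p.1 hpr) (by linarith [hpr.2])
      (by linarith [hpr.1]) (by linarith [hpr.1]) (by linarith [hpr.2]) hT1 hTM hlam hTlam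
      hc0 hc0κ).trans (le_of_eq ?_)
    have s1 := pdv_comm hr hθ hψ er eθ hp
    have s2 := pdv_comm hr hθ hψ er ez hp
    have s3 := pdv_comm hr hθ hψ eθ ez hp
    rw [s1, s2, s3]
    linear_combination (-(r₁ - p.1) * pdv K er ψ p) * heq1 p hp - Ψ p * heq2 p hp

lemma exists_abs_le_of_continuousOn {f : ℝ → ℝ} {a b : ℝ} {I : Set ℝ} (hf : ContinuousOn f I)
    (hI : Icc a b ⊆ I) : ∃ M, 0 ≤ M ∧ ∀ r ∈ Icc a b, |f r| ≤ M := by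
  obtain ⟨M, hM⟩ := isCompact_Icc.exists_bound_of_continuousOn (hf.mono hI)
  exact ⟨max M 0, le_max_right _ _, fun r hr => (hM r hr).trans (le_max_left _ _)⟩

lemma contDiffOn_rhoBar {J₀ : ℝ} {U : ℝ → ℝ} {I : Set ℝ} {n : WithTop ℕ∞}
    (hU : ContDiffOn ℝ n U I) (hpos : ∀ r ∈ I, 0 < r ∧ 0 < U r) :
    ContDiffOn ℝ n (rhoBar J₀ U) I :=
  contDiffOn_const.div (contDiffOn_id.mul hU) fun r hr =>
    (mul_pos (hpos r hr).1 (hpos r hr).2).ne'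

lemma rhoBar_pos {J₀ : ℝ} (hJ : 0 < J₀) {U : ℝ → ℝ} {r : ℝ} (hr : 0 < r) (hU : 0 < U r) :
    0 < rhoBar J₀ U r := div_pos hJ (mul_pos hr hU)

lemma c2Bar_pos {γ S₀ J₀ : ℝ} (hγ : 0 < γ) (hJ : 0 < J₀) {U : ℝ → ℝ} {r : ℝ} (hr : 0 < r)
    (hU : 0 < U r) : 0 < c2Bar γ S₀ J₀ U r :=
  mul_pos (mul_pos hγ (Real.exp_pos _)) (Real.rpow_pos_of_pos (rhoBar_pos hJ hr hU) _)

lemma contDiffOn_c2Bar {γ S₀ J₀ : ℝ} (hJ : 0 < J₀) {U : ℝ → ℝ} {I : Set ℝ} {n : WithTop ℕ∞}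
    (hU : ContDiffOn ℝ n U I) (hpos : ∀ r ∈ I, 0 < r ∧ 0 < U r) :
    ContDiffOn ℝ n (c2Bar γ S₀ J₀ U) I :=
  contDiffOn_const.mul ((contDiffOn_rhoBar hU hpos).rpow_const_of_ne fun r hr =>
    (rhoBar_pos hJ (hpos r hr).1 (hpos r hr).2).ne')

/-- `H¹` energy estimate for the linearized second-order
hyperbolic–elliptic coupled system at a cylindrically symmetric supersonic
background Euler–Poisson flow, uniform over all smooth coefficients
`A_{ij}` that are `δ₁`-close in `C¹` to the background coefficients and
satisfy the stated structural conditions. -/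
theorem stmt_5 (γ r₀ b₀ ρ₀ U₀ S₀ E₀ θ₀ R₀ μ₁ ε₀ : ℝ)
    (Ubar Ebar U' E' : ℝ → ℝ)
    (hγ : 1 < γ) (hr₀ : 0 < r₀) (hb₀ : 0 < b₀) (hρ₀ : 0 < ρ₀)
    (hU₀ : 0 < U₀) (hS₀ : 0 < S₀)
    (hθ₀ : θ₀ ∈ Ioo 0 (Real.pi / 2)) (hR₀ : 0 < R₀)
    (hμ₁ : μ₁ ∈ Ioo (0 : ℝ) 1) (hε₀ : ε₀ ∈ Ioo 0 R₀)
    -- the background flow: a smooth solution of the background ODE system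
    (hUsm : ContDiffOn ℝ (⊤ : ℕ∞) Ubar (Ico r₀ (r₀ + R₀)))
    (hEsm : ContDiffOn ℝ (⊤ : ℕ∞) Ebar (Ico r₀ (r₀ + R₀)))
    (hIC : Ubar r₀ = U₀ ∧ Ebar r₀ = E₀)
    (hode : ∀ r ∈ Ico r₀ (r₀ + R₀),
      HasDerivWithinAt Ubar (U' r) (Ico r₀ (r₀ + R₀)) r ∧
      HasDerivWithinAt Ebar (E' r) (Ico r₀ (r₀ + R₀)) r ∧
      U' r = (r * Ubar r * Ebar r + c2Bar γ S₀ (r₀ * ρ₀ * U₀) Ubar r * Ubar r) /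
          (r * ((Ubar r) ^ 2 - c2Bar γ S₀ (r₀ * ρ₀ * U₀) Ubar r)) ∧
      E' r = rhoBar (r₀ * ρ₀ * U₀) Ubar r - b₀ - Ebar r / r)
    (hsup : ∀ r ∈ Ico r₀ (r₀ + R₀),
      0 < Ubar r ∧
      c2Bar γ S₀ (r₀ * ρ₀ * U₀) Ubar r < (Ubar r) ^ 2 ∧
      (Ubar r) ^ 3 < 2 * r₀ * (r₀ * ρ₀ * U₀)) :
    ∃ rbar₁ ∈ Ioc r₀ (r₀ + R₀ - ε₀), ∃ δ₁ > (0 : ℝ),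
      ∀ r₁ ∈ Ioo r₀ rbar₁, ∃ C > (0 : ℝ),
        ∀ A11 A12 A13 A22 A23 A33 : ℝ × ℝ × ℝ → ℝ,
          -- smooth coefficients on the closure of Ω
          ContDiffOn ℝ (⊤ : ℕ∞) A11 (closure (Cyl r₀ r₁ θ₀)) →
          ContDiffOn ℝ (⊤ : ℕ∞) A12 (closure (Cyl r₀ r₁ θ₀)) →
          ContDiffOn ℝ (⊤ : ℕ∞) A13 (closure (Cyl r₀ r₁ θ₀)) →
          ContDiffOn ℝ (⊤ : ℕ∞) A22 (closure (Cyl r₀ r₁ θ₀)) →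
          ContDiffOn ℝ (⊤ : ℕ∞) A23 (closure (Cyl r₀ r₁ θ₀)) →
          ContDiffOn ℝ (⊤ : ℕ∞) A33 (closure (Cyl r₀ r₁ θ₀)) →
          -- (a) pointwise bounds
          (∀ p ∈ closure (Cyl r₀ r₁ θ₀),
            μ₁ ≤ -A11 p ∧ -A11 p ≤ 1 / μ₁ ∧
            μ₁ ≤ A22 p ∧ A22 p ≤ 1 / μ₁ ∧
            μ₁ ≤ A33 p ∧ A33 p ≤ 1 / μ₁) →
          -- (b) positive definiteness of the (θ, z)-block
          (∀ p ∈ closure (Cyl r₀ r₁ θ₀), ∀ ξ₂ ξ₃ : ℝ,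
            μ₁ / 2 * (ξ₂ ^ 2 + ξ₃ ^ 2)
              ≤ A22 p * ξ₂ ^ 2 + 2 * A23 p * ξ₂ * ξ₃ + A33 p * ξ₃ ^ 2) →
          -- (c) compatibility conditions on the walls
          (∀ p ∈ closure (Cyl r₀ r₁ θ₀), (p.2.1 = θ₀ ∨ p.2.1 = -θ₀) →
            A12 p = 0 ∧ A23 p = 0) →
          (∀ p ∈ closure (Cyl r₀ r₁ θ₀), (p.2.2 = 1 ∨ p.2.2 = -1) →
            A13 p = 0 ∧ A23 p = 0) →
          -- (d) C¹-closeness to the background coefficients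
          (∀ p ∈ closure (Cyl r₀ r₁ θ₀),
            |A11 p - A11Bar γ S₀ (r₀ * ρ₀ * U₀) Ubar p.1|
              + ‖fderivWithin ℝ (fun q : ℝ × ℝ × ℝ =>
                  A11 q - A11Bar γ S₀ (r₀ * ρ₀ * U₀) Ubar q.1)
                  (closure (Cyl r₀ r₁ θ₀)) p‖ ≤ δ₁ ∧
            |A22 p - A22Bar γ S₀ (r₀ * ρ₀ * U₀) Ubar p.1|
              + ‖fderivWithin ℝ (fun q : ℝ × ℝ × ℝ =>
                  A22 q - A22Bar γ S₀ (r₀ * ρ₀ * U₀) Ubar q.1)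
                  (closure (Cyl r₀ r₁ θ₀)) p‖ ≤ δ₁ ∧
            |A33 p - c2Bar γ S₀ (r₀ * ρ₀ * U₀) Ubar p.1|
              + ‖fderivWithin ℝ (fun q : ℝ × ℝ × ℝ =>
                  A33 q - c2Bar γ S₀ (r₀ * ρ₀ * U₀) Ubar q.1)
                  (closure (Cyl r₀ r₁ θ₀)) p‖ ≤ δ₁ ∧
            |A12 p| + ‖fderivWithin ℝ A12 (closure (Cyl r₀ r₁ θ₀)) p‖ ≤ δ₁ ∧
            |A13 p| + ‖fderivWithin ℝ A13 (closure (Cyl r₀ r₁ θ₀)) p‖ ≤ δ₁ ∧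
            |A23 p| + ‖fderivWithin ℝ A23 (closure (Cyl r₀ r₁ θ₀)) p‖ ≤ δ₁) →
          ∀ ψ Ψ F₃ F₄ : ℝ × ℝ × ℝ → ℝ, ∀ F₅ : ℝ × ℝ → ℝ,
            ContDiffOn ℝ 2 ψ (closure (Cyl r₀ r₁ θ₀)) →
            ContDiffOn ℝ 2 Ψ (closure (Cyl r₀ r₁ θ₀)) →
            ContinuousOn F₃ (closure (Cyl r₀ r₁ θ₀)) →
            ContinuousOn F₄ (closure (Cyl r₀ r₁ θ₀)) →
            ContinuousOn F₅ (closure (CrossD θ₀)) →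
            -- first (hyperbolic) equation in Ω
            (∀ p ∈ Cyl r₀ r₁ θ₀,
              A11 p * pdv (closure (Cyl r₀ r₁ θ₀)) er
                  (pdv (closure (Cyl r₀ r₁ θ₀)) er ψ) p
                + 2 * A12 p * pdv (closure (Cyl r₀ r₁ θ₀)) eθ
                  (pdv (closure (Cyl r₀ r₁ θ₀)) er ψ) p
                + 2 * A13 p * pdv (closure (Cyl r₀ r₁ θ₀)) ez
                  (pdv (closure (Cyl r₀ r₁ θ₀)) er ψ) p
                + A22 p * pdv (closure (Cyl r₀ r₁ θ₀)) eθ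
                  (pdv (closure (Cyl r₀ r₁ θ₀)) eθ ψ) p
                + 2 * A23 p * pdv (closure (Cyl r₀ r₁ θ₀)) ez
                  (pdv (closure (Cyl r₀ r₁ θ₀)) eθ ψ) p
                + A33 p * pdv (closure (Cyl r₀ r₁ θ₀)) ez
                  (pdv (closure (Cyl r₀ r₁ θ₀)) ez ψ) p
                + a1Bar γ S₀ (r₀ * ρ₀ * U₀) Ubar U' Ebar p.1
                    * pdv (closure (Cyl r₀ r₁ θ₀)) er ψ p
                + Ubar p.1 * pdv (closure (Cyl r₀ r₁ θ₀)) er Ψ p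
                + b2Bar γ Ubar U' p.1 * Ψ p
                = F₃ p) →
            -- second (elliptic) equation in Ω
            (∀ p ∈ Cyl r₀ r₁ θ₀,
              pdv (closure (Cyl r₀ r₁ θ₀)) er
                  (pdv (closure (Cyl r₀ r₁ θ₀)) er Ψ) p
                + (1 / p.1) * pdv (closure (Cyl r₀ r₁ θ₀)) er Ψ p
                + (1 / p.1 ^ 2) * pdv (closure (Cyl r₀ r₁ θ₀)) eθ
                  (pdv (closure (Cyl r₀ r₁ θ₀)) eθ Ψ) p
                + pdv (closure (Cyl r₀ r₁ θ₀)) ez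
                  (pdv (closure (Cyl r₀ r₁ θ₀)) ez Ψ) p
                + a2Bar γ S₀ (r₀ * ρ₀ * U₀) Ubar p.1
                    * pdv (closure (Cyl r₀ r₁ θ₀)) er ψ p
                - b3Bar γ S₀ (r₀ * ρ₀ * U₀) Ubar p.1 * Ψ p
                = F₄ p) →
            -- boundary conditions at the entrance and the exit
            (∀ q ∈ Icc (-θ₀) θ₀ ×ˢ Icc (-1 : ℝ) 1,
              ψ (r₀, q.1, q.2) = 0 ∧
              pdv (closure (Cyl r₀ r₁ θ₀)) er ψ (r₀, q.1, q.2) = F₅ q ∧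
              pdv (closure (Cyl r₀ r₁ θ₀)) er Ψ (r₀, q.1, q.2) = 0 ∧
              Ψ (r₁, q.1, q.2) = 0) →
            -- boundary conditions on the side walls θ = ±θ₀
            (∀ p ∈ closure (Cyl r₀ r₁ θ₀), (p.2.1 = θ₀ ∨ p.2.1 = -θ₀) →
              pdv (closure (Cyl r₀ r₁ θ₀)) eθ ψ p = 0 ∧
              pdv (closure (Cyl r₀ r₁ θ₀)) eθ Ψ p = 0) →
            -- boundary conditions on the walls z = ±1
            (∀ p ∈ closure (Cyl r₀ r₁ θ₀), (p.2.2 = 1 ∨ p.2.2 = -1) →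
              pdv (closure (Cyl r₀ r₁ θ₀)) ez ψ p = 0 ∧
              pdv (closure (Cyl r₀ r₁ θ₀)) ez Ψ p = 0) →
            -- the H¹ energy estimate
            (∫ p in Cyl r₀ r₁ θ₀,
                ((ψ p) ^ 2 + (pdv (closure (Cyl r₀ r₁ θ₀)) er ψ p) ^ 2
                  + (pdv (closure (Cyl r₀ r₁ θ₀)) eθ ψ p) ^ 2
                  + (pdv (closure (Cyl r₀ r₁ θ₀)) ez ψ p) ^ 2
                  + (Ψ p) ^ 2 + (pdv (closure (Cyl r₀ r₁ θ₀)) er Ψ p) ^ 2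
                  + (pdv (closure (Cyl r₀ r₁ θ₀)) eθ Ψ p) ^ 2
                  + (pdv (closure (Cyl r₀ r₁ θ₀)) ez Ψ p) ^ 2))
              ≤ C * ((∫ p in Cyl r₀ r₁ θ₀, ((F₃ p) ^ 2 + (F₄ p) ^ 2))
                  + ∫ q in CrossD θ₀, (F₅ q) ^ 2) := by
  have hJ : 0 < r₀ * ρ₀ * U₀ := by positivity
  set J₀ := r₀ * ρ₀ * U₀
  set I := Ico r₀ (r₀ + R₀)
  obtain ⟨hε0, hεR⟩ := hε₀
  obtain ⟨hμ0, hμ1⟩ := hμ₁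
  have hpos : ∀ r ∈ I, 0 < r ∧ 0 < Ubar r := fun r hr => ⟨hr₀.trans_le hr.1, (hsup r hr).1⟩
  have hsub : Icc r₀ (r₀ + R₀ - ε₀) ⊆ I := fun r hr => ⟨hr.1, by linarith [hr.2]⟩
  have hIu : UniqueDiffOn ℝ I := uniqueDiffOn_Ico _ _
  have hU1 : ContDiffOn ℝ 1 Ubar I := hUsm.of_le (by exact_mod_cast le_top)
  have hρ1 : ContDiffOn ℝ 1 (rhoBar J₀ Ubar) I := contDiffOn_rhoBar hU1 hpos
  have hc1 : ContDiffOn ℝ 1 (c2Bar γ S₀ J₀ Ubar) I := contDiffOn_c2Bar hJ hU1 hpos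
  have hA11 : ContDiffOn ℝ 1 (A11Bar γ S₀ J₀ Ubar) I := hc1.sub (hU1.pow 2)
  have hA22 : ContDiffOn ℝ 1 (A22Bar γ S₀ J₀ Ubar) I :=
    hc1.div (contDiffOn_id.pow 2) fun r hr => pow_ne_zero 2 (hpos r hr).1.ne'
  have hUc := hU1.continuousOn
  have hEc := hEsm.continuousOn
  have hρc := hρ1.continuousOn
  have hcc := hc1.continuousOn
  have hr0 : ∀ r ∈ I, r ≠ 0 := fun r hr => (hpos r hr).1.ne'
  have hc0 : ∀ r ∈ I, c2Bar γ S₀ J₀ Ubar r ≠ 0 := fun r hr =>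
    (c2Bar_pos (by linarith) hJ (hpos r hr).1 (hpos r hr).2).ne'
  have hU'c : ContinuousOn U' I := by
    refine ContinuousOn.congr (f := fun r => (r * Ubar r * Ebar r + c2Bar γ S₀ J₀ Ubar r * Ubar r) /
          (r * ((Ubar r) ^ 2 - c2Bar γ S₀ J₀ Ubar r))) ?_ fun r hr => (hode r hr).2.2.1
    refine ContinuousOn.div (by fun_prop) (by fun_prop) fun r hr => ?_
    exact mul_ne_zero (hr0 r hr) (sub_pos.2 (hsup r hr).2.1).ne'
  have ha1c : ContinuousOn (a1Bar γ S₀ J₀ Ubar U' Ebar) I := by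
    unfold a1Bar
    fun_prop (disch := assumption)
  have ha2c : ContinuousOn (a2Bar γ S₀ J₀ Ubar) I := by
    unfold a2Bar
    fun_prop (disch := assumption)
  have hb2c : ContinuousOn (b2Bar γ Ubar U') I := by
    unfold b2Bar
    fun_prop (disch := assumption)
  have hb3c : ContinuousOn (b3Bar γ S₀ J₀ Ubar) I := by
    unfold b3Bar
    fun_prop (disch := assumption)
  obtain ⟨M1, p1, m1⟩ := exists_abs_le_of_continuousOn ha1c hsub
  obtain ⟨M2, p2, m2⟩ := exists_abs_le_of_continuousOn hUc hsub
  obtain ⟨M3, p3, m3⟩ := exists_abs_le_of_continuousOn hb2c hsub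
  obtain ⟨M4, p4, m4⟩ := exists_abs_le_of_continuousOn ha2c hsub
  obtain ⟨M5, p5, m5⟩ := exists_abs_le_of_continuousOn hb3c hsub
  obtain ⟨M6, p6, m6⟩ := exists_abs_le_of_continuousOn
    (hA11.continuousOn_derivWithin hIu le_rfl) hsub
  obtain ⟨M7, p7, m7⟩ := exists_abs_le_of_continuousOn
    (hA22.continuousOn_derivWithin hIu le_rfl) hsub
  obtain ⟨M8, p8, m8⟩ := exists_abs_le_of_continuousOn
    (hc1.continuousOn_derivWithin hIu le_rfl) hsub
  have p9 : 0 < 1 / r₀ := by positivity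
  obtain ⟨M, hMdef⟩ : ∃ M, M = 1 + M1 + M2 + M3 + M4 + M5 + M6 + M7 + M8 + 1 / r₀ := ⟨_, rfl⟩
  have hM : 1 ≤ M := by linarith
  obtain ⟨lam, hlam⟩ : ∃ lam, lam = 8 * M ^ 2 / μ₁ + 2 * M ^ 2 + 2 * M + 6 := ⟨_, rfl⟩
  have hlam0 : 0 < lam := by rw [hlam]; positivity
  obtain ⟨κ, hκdef⟩ : ∃ κ, κ = 1 / (r₀ + R₀) ^ 2 := ⟨_, rfl⟩
  have hκ0 : 0 < κ := by rw [hκdef]; positivity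
  obtain ⟨T, hTdef⟩ : ∃ T, T = min (min 1 (R₀ - ε₀)) (min (μ₁ / (160 * M)) (1 / (8 * lam))) :=
    ⟨_, rfl⟩
  have hT0 : 0 < T := by
    rw [hTdef]
    exact lt_min (lt_min one_pos (by linarith)) (lt_min (by positivity) (by positivity))
  have hT1 : T ≤ 1 := hTdef.trans_le ((min_le_left _ _).trans (min_le_left _ _))
  have hT2 : T ≤ R₀ - ε₀ := hTdef.trans_le ((min_le_left _ _).trans (min_le_right _ _))
  have hT3 : T ≤ μ₁ / (160 * M) := hTdef.trans_le ((min_le_right _ _).trans (min_le_left _ _))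
  have hT4 : T ≤ 1 / (8 * lam) := hTdef.trans_le ((min_le_right _ _).trans (min_le_right _ _))
  refine ⟨r₀ + T, ⟨by linarith, by linarith⟩, 1, one_pos, fun r₁ hr₁ => ?_⟩
  obtain ⟨c0, hc0def⟩ : ∃ c0, c0 = min (μ₁ / 16) κ := ⟨_, rfl⟩
  have hc0pos : 0 < c0 := by rw [hc0def]; exact lt_min (by positivity) hκ0
  refine ⟨1 / μ₁ / c0, by positivity, ?_⟩
  intro A11 A12 A13 A22 A23 A33 s11 s12 s13 s22 s23 s33 hbd hell hwθ hwz hclose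
    ψ Ψ F₃ F₄ F₅ hψ hΨ hF₃ hF₄ hF₅ heq1 heq2 hbr hbθ hbz
  have hr : r₀ < r₁ := hr₁.1
  have hθ := hθ₀.1
  have hsub1 : Ioo r₀ r₁ ⊆ Icc r₀ (r₀ + R₀ - ε₀) := fun r hrr =>
    ⟨hrr.1.le, by linarith [hrr.2, hr₁.2]⟩
  have hS := uniqueDiffOn_closure_Cyl hr hθ
  have hKfst : ∀ p ∈ closure (Cyl r₀ r₁ θ₀), p.1 ∈ Icc r₀ (r₀ + R₀ - ε₀) := by
    intro p hp
    rw [closure_Cyl hr hθ] at hp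
    exact ⟨hp.1.1, by linarith [hp.1.2, hr₁.2]⟩
  have hKI : ∀ p ∈ closure (Cyl r₀ r₁ θ₀), p.1 ∈ I := fun p hp => hsub (hKfst p hp)
  have hle : (1 : WithTop ℕ∞) ≤ ((⊤ : ℕ∞) : WithTop ℕ∞) := by exact_mod_cast le_top
  have hder : ∀ {f : ℝ → ℝ}, ContDiffOn ℝ 1 f I → ∀ r ∈ I,
      HasDerivWithinAt f (derivWithin f I r) I r := fun hf r hr =>
    (hf.differentiableOn (by simp) r hr).hasDerivWithinAt
  have hmain := energy_estimate (M := M) (μ := μ₁) (κ := κ) (lam := lam) (c0 := c0)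
    (a1 := a1Bar γ S₀ J₀ Ubar U' Ebar) (U := Ubar) (b2 := b2Bar γ Ubar U')
    (a2 := a2Bar γ S₀ J₀ Ubar) (b3 := b3Bar γ S₀ J₀ Ubar)
    hr₀ hr hθ hμ0 hμ1 hM (by linarith [hr₁.2])
    (by
      have h := (le_div_iff₀ (by positivity)).1 hT3
      have h2 := mul_le_mul_of_nonneg_left (by linarith [hr₁.2] : r₁ - r₀ ≤ T)
        (by positivity : 0 ≤ 160 * M)
      linarith)
    hlam
    (by
      have h := (le_div_iff₀ (by positivity)).1 hT4
      have h2 := mul_le_mul_of_nonneg_left (by linarith [hr₁.2] : r₁ - r₀ ≤ T)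
        (by positivity : 0 ≤ 8 * lam)
      linarith)
    (hc0def.trans_le (min_le_left _ _)) (hc0def.trans_le (min_le_right _ _))
    (fun r hrr => by
      have h0 : 0 < r := hr₀.trans hrr.1
      have h1 : r ≤ r₀ + R₀ := by linarith [(hsub1 hrr).2]
      rw [hκdef]
      exact one_div_le_one_div_of_le (by positivity) (pow_le_pow_left₀ h0.le h1 2))
    (fun r hrr => by
      have h0 : 0 < r := hr₀.trans hrr.1
      rw [abs_of_pos (by positivity)]
      have := one_div_le_one_div_of_le hr₀ hrr.1.le
      linarith)
    (fun r hrr => by linarith [m1 r (hsub1 hrr)]) (fun r hrr => by linarith [m2 r (hsub1 hrr)])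
    (fun r hrr => by linarith [m3 r (hsub1 hrr)]) (fun r hrr => by linarith [m4 r (hsub1 hrr)])
    (fun r hrr => by linarith [m5 r (hsub1 hrr)]) rfl
    (s11.of_le hle) (s12.of_le hle) (s13.of_le hle) (s22.of_le hle) (s23.of_le hle)
    (s33.of_le hle) (fun p hp => ⟨(hbd p hp).1, (hbd p hp).2.1⟩) hell hwθ hwz
    (fun v hv p hp => by
      obtain ⟨n11, n22, n33, n12, n13, n23⟩ := hclose p hp
      have q11 := abs_pdv_le_of_sub_comp_fst (s11.of_le hle) hv hp (hS p hp)
        (hder hA11 p.1 (hKI p hp)) hKI (m6 p.1 (hKfst p hp))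
        ((le_add_of_nonneg_left (abs_nonneg _)).trans n11)
      have q22 := abs_pdv_le_of_sub_comp_fst (s22.of_le hle) hv hp (hS p hp)
        (hder hA22 p.1 (hKI p hp)) hKI (m7 p.1 (hKfst p hp))
        ((le_add_of_nonneg_left (abs_nonneg _)).trans n22)
      have q33 := abs_pdv_le_of_sub_comp_fst (s33.of_le hle) hv hp (hS p hp)
        (hder hc1 p.1 (hKI p hp)) hKI (m8 p.1 (hKfst p hp))
        ((le_add_of_nonneg_left (abs_nonneg _)).trans n33)
      have q12 := (abs_pdv_le A12 hv p).trans
        ((le_add_of_nonneg_left (abs_nonneg _)).trans n12)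
      have q13 := (abs_pdv_le A13 hv p).trans
        ((le_add_of_nonneg_left (abs_nonneg _)).trans n13)
      have q23 := (abs_pdv_le A23 hv p).trans
        ((le_add_of_nonneg_left (abs_nonneg _)).trans n23)
      exact ⟨by linarith, by linarith, by linarith, by linarith, by linarith, by linarith⟩)
    hψ hΨ hF₃ hF₄ hF₅ heq1 heq2 hbr hbθ hbz
  have hFnn : 0 ≤ ∫ p in Cyl r₀ r₁ θ₀, ((F₃ p) ^ 2 + (F₄ p) ^ 2) :=
    integral_nonneg fun p => by positivity
  have hμinv : 1 ≤ 1 / μ₁ := by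
    rw [le_div_iff₀ hμ0]
    linarith
  have h3 := mul_le_mul_of_nonneg_right hμinv hFnn
  rw [div_mul_eq_mul_div, le_div_iff₀ hc0pos]
  linarith
end

section
/- Let 0 < r₀ < r₁ and let ρ, U₁, U₃ : [r₀, r₁] × [−1, 1] → ℝ be continuously differentiable with ρ > 0 and U₁ > 0 everywhere, satisfying the continuity equation ∂_r(rρU₁) + ∂_z(rρU₃) = 0 on [r₀, r₁] × [−1, 1] and the slip condition U₃(r, ±1) = 0 for all r. Define ℒ(r, z) = ∫_{−1}^{z} r₀(ρU₁)(r₀, s) ds − ∫_{r₀}^{r} s(ρU₃)(s, z) ds. Then: (i) ∂_zℒ(r, z) = r ρ(r,z) U₁(r,z) > 0 and ∂_rℒ(r, z) = −r ρ(r,z) U₃(r,z) everywhere; (ii) ℒ(r, −1) = 0 and ℒ(r, 1) = ℒ(r₀, 1) for every r, and for each fixed r the map z ↦ ℒ(r, z) is a strictly increasing bijection from [−1, 1] onto [0, ℒ(r₀, 1)]; (iii) denoting by ℒ_{r₀}^{−1} : [0, ℒ(r₀, 1)] → [−1, 1] the inverse of z ↦ ℒ(r₀, z), for every continuously differentiable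 g : [−1, 1] → ℝ the function W(r, z) = (r₀/r) g(ℒ_{r₀}^{−1}(ℒ(r, z))) is continuously differentiable, satisfies the transport equation U₁∂_r(rW) + U₃∂_z(rW) = 0 on (r₀, r₁) × (−1, 1), and satisfies the entrance condition W(r₀, z) = g(z) for all z ∈ [−1, 1]. -/
open Set

/-- The closed rectangle `[r₀, r₁] × [−1, 1]` in the `(r, z)`-plane. -/
def Rect (r₀ r₁ : ℝ) : Set (ℝ × ℝ) := Icc r₀ r₁ ×ˢ Icc (-1 : ℝ) 1

/-- The stream function
`ℒ(r,z) = ∫_{−1}^{z} r₀(ρU₁)(r₀,s) ds − ∫_{r₀}^{r} s(ρU₃)(s,z) ds`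
of the divergence-free field `(rρU₁, rρU₃)`. -/
noncomputable def streamL (r₀ : ℝ) (ρ U₁ U₃ : ℝ × ℝ → ℝ) (p : ℝ × ℝ) : ℝ :=
  (∫ s in (-1 : ℝ)..p.2, r₀ * (ρ (r₀, s) * U₁ (r₀, s)))
    - ∫ s in r₀..p.1, s * (ρ (s, p.2) * U₃ (s, p.2))

/-- A function on a rectangle whose horizontal and vertical increments are integrals of continuous
functions `Q` and `P` is differentiable with partial derivatives `Q` and `P`. -/
theorem hasFDerivWithinAt_of_increments {a b c d : ℝ} {S P Q : ℝ × ℝ → ℝ}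
    (hP : ContinuousOn P (Icc a b ×ˢ Icc c d)) (hQ : ContinuousOn Q (Icc a b ×ˢ Icc c d))
    (hv : ∀ x ∈ Icc a b, ∀ y ∈ Icc c d, ∀ y' ∈ Icc c d,
      S (x, y') - S (x, y) = ∫ t in y..y', P (x, t))
    (hh : ∀ y ∈ Icc c d, ∀ x ∈ Icc a b, ∀ x' ∈ Icc a b,
      S (x', y) - S (x, y) = ∫ t in x..x', Q (t, y))
    {p : ℝ × ℝ} (hp : p ∈ Icc a b ×ˢ Icc c d) :
    HasFDerivWithinAt S (Q p • ContinuousLinearMap.fst ℝ ℝ ℝ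
      + P p • ContinuousLinearMap.snd ℝ ℝ ℝ) (Icc a b ×ˢ Icc c d) p := by
  refine HasFDerivWithinAt.of_isLittleO ?_
  rw [Asymptotics.isLittleO_iff]
  intro ε hε
  obtain ⟨δ₁, hδ₁, h₁⟩ := Metric.continuousWithinAt_iff.1 (hP p hp) (ε / 2) (half_pos hε)
  obtain ⟨δ₂, hδ₂, h₂⟩ := Metric.continuousWithinAt_iff.1 (hQ p hp) (ε / 2) (half_pos hε)
  have hball : Metric.ball p (min δ₁ δ₂) ∈ nhds p := Metric.ball_mem_nhds _ (lt_min hδ₁ hδ₂)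
  filter_upwards [mem_nhdsWithin_of_mem_nhds hball, self_mem_nhdsWithin] with q hqb hq
  obtain ⟨p₁, p₂⟩ := p
  obtain ⟨q₁, q₂⟩ := q
  obtain ⟨hp1, hp2⟩ := hp
  obtain ⟨hq1, hq2⟩ := hq
  simp only at hp1 hp2 hq1 hq2
  rw [Metric.mem_ball, lt_min_iff, Prod.dist_eq, max_lt_iff, max_lt_iff] at hqb
  simp only [Real.dist_eq] at hqb
  have hJ : ∀ t ∈ uIcc p₂ q₂, (q₁, t) ∈ Icc a b ×ˢ Icc c d := fun t ht =>
    ⟨hq1, (uIcc_subset_Icc hp2 hq2) ht⟩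
  have hI : ∀ t ∈ uIcc p₁ q₁, (t, p₂) ∈ Icc a b ×ˢ Icc c d := fun t ht =>
    ⟨(uIcc_subset_Icc hp1 hq1) ht, hp2⟩
  have iP : IntervalIntegrable (fun t => P (q₁, t)) MeasureTheory.volume p₂ q₂ :=
    (hP.comp (by fun_prop) hJ).intervalIntegrable
  have iQ : IntervalIntegrable (fun t => Q (t, p₂)) MeasureTheory.volume p₁ q₁ :=
    (hQ.comp (by fun_prop) hI).intervalIntegrable
  have e : S (q₁, q₂) - S (p₁, p₂) - (Q (p₁, p₂) * (q₁ - p₁) + P (p₁, p₂) * (q₂ - p₂))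
      = (∫ t in p₂..q₂, (P (q₁, t) - P (p₁, p₂))) + ∫ t in p₁..q₁, (Q (t, p₂) - Q (p₁, p₂)) := by
    rw [intervalIntegral.integral_sub iP (by simp), intervalIntegral.integral_sub iQ (by simp),
      ← hv q₁ hq1 p₂ hp2 q₂ hq2, ← hh p₂ hp2 p₁ hp1 q₁ hq1]
    simp only [intervalIntegral.integral_const, smul_eq_mul]
    ring
  have bP : ‖∫ t in p₂..q₂, (P (q₁, t) - P (p₁, p₂))‖ ≤ ε / 2 * |q₂ - p₂| := by
    refine intervalIntegral.norm_integral_le_of_norm_le_const fun t ht => ?_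
    refine (h₁ (hJ t (uIoc_subset_uIcc ht)) ?_).le
    rw [Prod.dist_eq, max_lt_iff]
    exact ⟨hqb.1.1, (abs_sub_left_of_mem_uIcc (uIoc_subset_uIcc ht)).trans_lt hqb.1.2⟩
  have bQ : ‖∫ t in p₁..q₁, (Q (t, p₂) - Q (p₁, p₂))‖ ≤ ε / 2 * |q₁ - p₁| := by
    refine intervalIntegral.norm_integral_le_of_norm_le_const fun t ht => ?_
    refine (h₂ (hI t (uIoc_subset_uIcc ht)) ?_).le
    rw [Prod.dist_eq, max_lt_iff]
    exact ⟨(abs_sub_left_of_mem_uIcc (uIoc_subset_uIcc ht)).trans_lt hqb.2.1, by simpa using hδ₂⟩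
  have n₁ : |q₁ - p₁| ≤ ‖(q₁, q₂) - (p₁, p₂)‖ := norm_fst_le ((q₁, q₂) - (p₁, p₂))
  have n₂ : |q₂ - p₂| ≤ ‖(q₁, q₂) - (p₁, p₂)‖ := norm_snd_le ((q₁, q₂) - (p₁, p₂))
  simp only [add_apply, smul_apply,
    ContinuousLinearMap.coe_fst', ContinuousLinearMap.coe_snd', Prod.fst_sub, Prod.snd_sub,
    smul_eq_mul]
  rw [e]
  refine (norm_add_le _ _).trans ?_
  nlinarith

/-- For a divergence-free `C¹` field `(P, Q)` on a rectangle, the flux through the boundary of any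
subrectangle vanishes. -/
theorem flux_eq_zero_of_divergence_free {a b c d : ℝ} {P Q : ℝ × ℝ → ℝ}
    (hP : ContDiffOn ℝ 1 P (Icc a b ×ˢ Icc c d)) (hQ : ContDiffOn ℝ 1 Q (Icc a b ×ˢ Icc c d))
    (hdiv : ∀ p ∈ Icc a b ×ˢ Icc c d, fderivWithin ℝ P (Icc a b ×ˢ Icc c d) p (1, 0)
      + fderivWithin ℝ Q (Icc a b ×ˢ Icc c d) p (0, 1) = 0)
    {x x' y y' : ℝ} (hx : x ∈ Icc a b) (hx' : x' ∈ Icc a b) (hy : y ∈ Icc c d)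
    (hy' : y' ∈ Icc c d) :
    ((∫ s in x..x', Q (s, y')) - ∫ s in x..x', Q (s, y)) + (∫ t in y..y', P (x', t))
      - ∫ t in y..y', P (x, t) = 0 := by
  have hsub : uIcc x x' ×ˢ uIcc y y' ⊆ Icc a b ×ˢ Icc c d :=
    prod_mono (uIcc_subset_Icc hx hx') (uIcc_subset_Icc hy hy')
  have hopen : ∀ p ∈ Ioo (min x x') (max x x') ×ˢ Ioo (min y y') (max y y'),
      Icc a b ×ˢ Icc c d ∈ nhds p := fun p hp =>
    Filter.mem_of_superset ((isOpen_Ioo.prod isOpen_Ioo).mem_nhds hp)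
      ((prod_mono Ioo_subset_Icc_self Ioo_subset_Icc_self).trans hsub)
  have hder : ∀ {F : ℝ × ℝ → ℝ}, ContDiffOn ℝ 1 F (Icc a b ×ˢ Icc c d) →
      ∀ p ∈ Ioo (min x x') (max x x') ×ˢ Ioo (min y y') (max y y'),
      HasFDerivAt F (fderivWithin ℝ F (Icc a b ×ˢ Icc c d) p) p := fun hF p hp =>
    ((hF.differentiableOn one_ne_zero p
      (mem_of_mem_nhds (hopen p hp))).hasFDerivWithinAt).hasFDerivAt (hopen p hp)
  have hmeas : MeasurableSet (uIcc x x' ×ˢ uIcc y y') := measurableSet_uIcc.prod measurableSet_uIcc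
  rw [← MeasureTheory.integral2_divergence_prod_of_hasFDerivAt P Q _ _ x y x' y'
    (hP.continuousOn.mono hsub) (hQ.continuousOn.mono hsub) (hder hP) (hder hQ)
    ((MeasureTheory.integrableOn_congr_fun (fun p hp => hdiv p (hsub hp)) hmeas).2
      MeasureTheory.integrableOn_zero)]
  rw [intervalIntegral.integral_congr (g := fun _ => 0), intervalIntegral.integral_zero]
  intro s hs
  simp only
  rw [intervalIntegral.integral_congr (g := fun _ => 0), intervalIntegral.integral_zero]
  intro t ht
  exact hdiv _ (hsub ⟨hs, ht⟩)

/-- The inverse of a function with positive continuous derivative on a compact interval extends to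
a `C¹` function on the line. -/
theorem exists_contDiff_leftInverse {c d : ℝ} (hcd : c < d) {F f : ℝ → ℝ}
    (hf : ContinuousOn f (Icc c d)) (hpos : ∀ z ∈ Icc c d, 0 < f z)
    (hF : ∀ z ∈ Icc c d, F z = ∫ t in c..z, f t) :
    ∃ G : ℝ → ℝ, ContDiff ℝ 1 G ∧ ∀ z ∈ Icc c d, G (F z) = z := by
  set e : ℝ → ℝ := IccExtend hcd.le ((Icc c d).domRestrict f) with he
  have hec : Continuous e := hf.domRestrict.Icc_extend'
  have hder : ∀ z, HasDerivAt (fun z => ∫ t in c..z, e t) (e z) z := fun z =>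
    intervalIntegral.integral_hasDerivAt_right (hec.intervalIntegrable _ _)
      (hec.stronglyMeasurableAtFilter _ _) hec.continuousAt
  obtain ⟨z₀, hz₀, hmin⟩ := isCompact_Icc.exists_isMinOn (nonempty_Icc.2 hcd.le) hf
  have hge : ∀ z, f z₀ ≤ e z := fun z => hmin (projIcc c d hcd.le z).2
  have hepos : ∀ z, 0 < e z := fun z => (hpos z₀ hz₀).trans_le (hge z)
  have hdiff : Differentiable ℝ (fun z => ∫ t in c..z, e t) := fun z => (hder z).differentiableAt
  have hderiv : deriv (fun z => ∫ t in c..z, e t) = e := funext fun z => (hder z).deriv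
  have hmono : StrictMono (fun z => ∫ t in c..z, e t) :=
    strictMono_of_deriv_pos fun z => by rw [hderiv]; exact hepos z
  have hgrow := mul_sub_le_image_sub_of_le_deriv hdiff (C := f z₀) (by rwa [hderiv])
  have hsurj : Function.Surjective (fun z => ∫ t in c..z, e t) := by
    refine hdiff.continuous.surjective ?_ ?_
    · refine Filter.tendsto_atTop_mono' _ ?_
        ((Filter.tendsto_id.atTop_add (tendsto_const_nhds (x := -c))).const_mul_atTop (hpos z₀ hz₀))
      filter_upwards [Filter.eventually_ge_atTop c] with z hz
      simpa [sub_eq_add_neg] using hgrow hz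
    · refine Filter.tendsto_atBot_mono' _ ?_
        ((Filter.tendsto_id.atBot_add (tendsto_const_nhds (x := -c))).const_mul_atBot (hpos z₀ hz₀))
      filter_upwards [Filter.eventually_le_atBot c] with z hz
      have := hgrow hz
      simp only [intervalIntegral.integral_same] at this
      simp only [id]
      linarith
  let H := (hmono.orderIsoOfSurjective _ hsurj).toHomeomorph
  have hC : ContDiff ℝ 1 (fun z => ∫ t in c..z, e t) :=
    contDiff_one_iff_deriv.2 ⟨hdiff, by rwa [hderiv]⟩
  refine ⟨H.symm, H.contDiff_symm_deriv (fun z => (hepos z).ne') hder hC, fun z hz => ?_⟩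
  have hFz : F z = H z := by
    rw [hF z hz]
    refine intervalIntegral.integral_congr fun t ht => ?_
    have ht' : t ∈ Icc c d := uIcc_subset_Icc (left_mem_Icc.2 hcd.le) hz ht
    exact (IccExtend_of_mem hcd.le ((Icc c d).domRestrict f) ht').symm
  rw [hFz, H.symm_apply_apply]

/-- properties of the stream function of an axisymmetric flow
with `ρ > 0`, `U₁ > 0`, continuity equation `∂_r(rρU₁) + ∂_z(rρU₃) = 0` and
slip condition `U₃(·, ±1) = 0`: (i) `∂_zℒ = rρU₁ > 0`, `∂_rℒ = −rρU₃`;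
(ii) `ℒ(·,−1) = 0`, `ℒ(·,1) = ℒ(r₀,1)` and `z ↦ ℒ(r,z)` is a strictly
increasing bijection of `[−1,1]` onto `[0, ℒ(r₀,1)]`; (iii) for the inverse
`ℒ_{r₀}^{-1}` of `z ↦ ℒ(r₀,z)` and any `C¹` function `g` on `[−1,1]`, the
function `W(r,z) = (r₀/r) g(ℒ_{r₀}^{-1}(ℒ(r,z)))` is `C¹`, solves the
transport equation `U₁∂_r(rW) + U₃∂_z(rW) = 0` in the open rectangle, and
satisfies `W(r₀, z) = g(z)`. -/
theorem stmt_12 (r₀ r₁ : ℝ) (hr₀ : 0 < r₀) (hr : r₀ < r₁)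
    (ρ U₁ U₃ : ℝ × ℝ → ℝ)
    (hρ : ContDiffOn ℝ 1 ρ (Rect r₀ r₁)) (hU₁ : ContDiffOn ℝ 1 U₁ (Rect r₀ r₁))
    (hU₃ : ContDiffOn ℝ 1 U₃ (Rect r₀ r₁))
    (hρpos : ∀ p ∈ Rect r₀ r₁, 0 < ρ p)
    (hU₁pos : ∀ p ∈ Rect r₀ r₁, 0 < U₁ p)
    (hcont : ∀ p ∈ Rect r₀ r₁,
      fderivWithin ℝ (fun q : ℝ × ℝ => q.1 * ρ q * U₁ q) (Rect r₀ r₁) p (1, 0)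
        + fderivWithin ℝ (fun q : ℝ × ℝ => q.1 * ρ q * U₃ q) (Rect r₀ r₁) p (0, 1) = 0)
    (hslip : ∀ r ∈ Icc r₀ r₁, U₃ (r, 1) = 0 ∧ U₃ (r, -1) = 0) :
    -- (i)
    (∀ p ∈ Rect r₀ r₁,
      HasFDerivWithinAt (streamL r₀ ρ U₁ U₃)
        ((-(p.1 * ρ p * U₃ p)) • ContinuousLinearMap.fst ℝ ℝ ℝ
          + (p.1 * ρ p * U₁ p) • ContinuousLinearMap.snd ℝ ℝ ℝ) (Rect r₀ r₁) p ∧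
      0 < p.1 * ρ p * U₁ p) ∧
    -- (ii)
    (∀ r ∈ Icc r₀ r₁,
      streamL r₀ ρ U₁ U₃ (r, -1) = 0 ∧
      streamL r₀ ρ U₁ U₃ (r, 1) = streamL r₀ ρ U₁ U₃ (r₀, 1) ∧
      StrictMonoOn (fun z => streamL r₀ ρ U₁ U₃ (r, z)) (Icc (-1 : ℝ) 1) ∧
      Set.BijOn (fun z => streamL r₀ ρ U₁ U₃ (r, z)) (Icc (-1 : ℝ) 1)
        (Icc 0 (streamL r₀ ρ U₁ U₃ (r₀, 1)))) ∧
    -- (iii)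
    (∀ Linv : ℝ → ℝ,
      (∀ z ∈ Icc (-1 : ℝ) 1, Linv (streamL r₀ ρ U₁ U₃ (r₀, z)) = z) →
      ∀ g : ℝ → ℝ, ContDiffOn ℝ 1 g (Icc (-1 : ℝ) 1) →
        ContDiffOn ℝ 1
          (fun p : ℝ × ℝ => (r₀ / p.1) * g (Linv (streamL r₀ ρ U₁ U₃ p)))
          (Rect r₀ r₁) ∧
        (∀ p ∈ Ioo r₀ r₁ ×ˢ Ioo (-1 : ℝ) 1,
          U₁ p * fderiv ℝ
              (fun q : ℝ × ℝ => q.1 * ((r₀ / q.1) * g (Linv (streamL r₀ ρ U₁ U₃ q)))) p (1, 0)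
            + U₃ p * fderiv ℝ
              (fun q : ℝ × ℝ => q.1 * ((r₀ / q.1) * g (Linv (streamL r₀ ρ U₁ U₃ q)))) p (0, 1)
            = 0) ∧
        (∀ z ∈ Icc (-1 : ℝ) 1,
          (r₀ / r₀) * g (Linv (streamL r₀ ρ U₁ U₃ (r₀, z))) = g z)) := by
  have hone : (-1 : ℝ) < 1 := by norm_num
  have hR : UniqueDiffOn ℝ (Rect r₀ r₁) := (uniqueDiffOn_Icc hr).prod (uniqueDiffOn_Icc hone)
  set L := streamL r₀ ρ U₁ U₃ with hL
  have hr₀mem : r₀ ∈ Icc r₀ r₁ := left_mem_Icc.2 hr.le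
  have hbot : (-1 : ℝ) ∈ Icc (-1 : ℝ) 1 := left_mem_Icc.2 hone.le
  have htop : (1 : ℝ) ∈ Icc (-1 : ℝ) 1 := right_mem_Icc.2 hone.le
  have hrpos : ∀ p ∈ Rect r₀ r₁, 0 < p.1 := fun p hp => hr₀.trans_le hp.1.1
  have hPC : ContDiffOn ℝ 1 (fun q : ℝ × ℝ => q.1 * ρ q * U₁ q) (Rect r₀ r₁) :=
    (contDiff_fst.contDiffOn.mul hρ).mul hU₁
  have hQC : ContDiffOn ℝ 1 (fun q : ℝ × ℝ => q.1 * ρ q * U₃ q) (Rect r₀ r₁) :=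
    (contDiff_fst.contDiffOn.mul hρ).mul hU₃
  have hPpos : ∀ p ∈ Rect r₀ r₁, 0 < p.1 * ρ p * U₁ p := fun p hp =>
    mul_pos (mul_pos (hrpos p hp) (hρpos p hp)) (hU₁pos p hp)
  have hPint : ∀ x ∈ Icc r₀ r₁, ∀ y ∈ Icc (-1 : ℝ) 1, ∀ y' ∈ Icc (-1 : ℝ) 1,
      IntervalIntegrable (fun t => x * ρ (x, t) * U₁ (x, t)) MeasureTheory.volume y y' :=
    fun x hx y hy y' hy' => ContinuousOn.intervalIntegrable <|
      hPC.continuousOn.comp (f := fun t => (x, t)) (by fun_prop)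
        fun t ht => ⟨hx, uIcc_subset_Icc hy hy' ht⟩
  have hQint : ∀ y ∈ Icc (-1 : ℝ) 1, ∀ x ∈ Icc r₀ r₁, ∀ x' ∈ Icc r₀ r₁,
      IntervalIntegrable (fun s => s * ρ (s, y) * U₃ (s, y)) MeasureTheory.volume x x' :=
    fun y hy x hx x' hx' => ContinuousOn.intervalIntegrable <|
      hQC.continuousOn.comp (f := fun s => (s, y)) (by fun_prop)
        fun s hs => ⟨uIcc_subset_Icc hx hx' hs, hy⟩
  have hLdef : ∀ x y, L (x, y) = (∫ t in (-1 : ℝ)..y, r₀ * ρ (r₀, t) * U₁ (r₀, t))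
      - ∫ s in r₀..x, s * ρ (s, y) * U₃ (s, y) := fun x y => by
    simp only [hL, streamL, mul_assoc]
  have hhor : ∀ y ∈ Icc (-1 : ℝ) 1, ∀ x ∈ Icc r₀ r₁, ∀ x' ∈ Icc r₀ r₁,
      L (x', y) - L (x, y) = ∫ s in x..x', -(s * ρ (s, y) * U₃ (s, y)) := by
    intro y hy x hx x' hx'
    rw [hLdef, hLdef, intervalIntegral.integral_neg, ← intervalIntegral.integral_interval_sub_left
      (hQint y hy r₀ hr₀mem x' hx') (hQint y hy r₀ hr₀mem x hx)]
    ring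
  have hver : ∀ x ∈ Icc r₀ r₁, ∀ y ∈ Icc (-1 : ℝ) 1, ∀ y' ∈ Icc (-1 : ℝ) 1,
      L (x, y') - L (x, y) = ∫ t in y..y', x * ρ (x, t) * U₁ (x, t) := by
    intro x hx y hy y' hy'
    have hflux := flux_eq_zero_of_divergence_free hPC hQC hcont hr₀mem hx hy hy'
    rw [← intervalIntegral.integral_interval_sub_left (hPint r₀ hr₀mem (-1) hbot y' hy')
      (hPint r₀ hr₀mem (-1) hbot y hy)] at hflux
    rw [hLdef, hLdef]
    linarith
  have hLder : ∀ p ∈ Rect r₀ r₁, HasFDerivWithinAt L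
      ((-(p.1 * ρ p * U₃ p)) • ContinuousLinearMap.fst ℝ ℝ ℝ
        + (p.1 * ρ p * U₁ p) • ContinuousLinearMap.snd ℝ ℝ ℝ) (Rect r₀ r₁) p := fun p hp =>
    hasFDerivWithinAt_of_increments (P := fun q => q.1 * ρ q * U₁ q)
      (Q := fun q => -(q.1 * ρ q * U₃ q)) hPC.continuousOn hQC.continuousOn.neg hver hhor hp
  have hLbot : ∀ x ∈ Icc r₀ r₁, L (x, -1) = 0 := by
    intro x hx
    rw [hLdef, intervalIntegral.integral_same, intervalIntegral.integral_congr (g := fun _ => 0)]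
    · simp
    · intro s hs
      simp [(hslip s (uIcc_subset_Icc hr₀mem hx hs)).2]
  have hLtop : ∀ x ∈ Icc r₀ r₁, L (x, 1) = L (r₀, 1) := by
    intro x hx
    rw [← sub_eq_zero, hhor 1 htop r₀ hr₀mem x hx,
      intervalIntegral.integral_congr (g := fun _ => 0)]
    · simp
    · intro s hs
      simp [(hslip s (uIcc_subset_Icc hr₀mem hx hs)).1]
  have hmono : ∀ x ∈ Icc r₀ r₁, StrictMonoOn (fun z => L (x, z)) (Icc (-1 : ℝ) 1) := by
    intro x hx y hy y' hy' hyy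
    rw [← sub_pos, hver x hx y hy y' hy']
    exact intervalIntegral.intervalIntegral_pos_of_pos_on (hPint x hx y hy y' hy')
      (fun t ht => hPpos (x, t) ⟨hx, hy.1.trans ht.1.le, ht.2.le.trans hy'.2⟩) hyy
  have hLcont : ContinuousOn L (Rect r₀ r₁) := fun p hp => (hLder p hp).continuousWithinAt
  have hbij : ∀ x ∈ Icc r₀ r₁,
      BijOn (fun z => L (x, z)) (Icc (-1 : ℝ) 1) (Icc 0 (L (r₀, 1))) := by
    intro x hx
    refine ⟨fun z hz => ?_, (hmono x hx).injOn, ?_⟩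
    · rw [← hLbot x hx, ← hLtop x hx]
      exact ⟨(hmono x hx).monotoneOn hbot hz hz.1, (hmono x hx).monotoneOn hz htop hz.2⟩
    · rw [← hLbot x hx, ← hLtop x hx]
      exact intermediate_value_Icc hone.le
        (hLcont.comp (f := fun z => (x, z)) (by fun_prop) fun z hz => ⟨hx, hz⟩)
  refine ⟨fun p hp => ⟨hLder p hp, hPpos p hp⟩,
    fun x hx => ⟨hLbot x hx, hLtop x hx, hmono x hx, hbij x hx⟩, fun Linv hLinv g hg => ?_⟩
  obtain ⟨G, hG, hGL⟩ := exists_contDiff_leftInverse hone (F := fun z => L (r₀, z))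
    (f := fun t => r₀ * ρ (r₀, t) * U₁ (r₀, t))
    (hPC.continuousOn.comp (f := fun t => (r₀, t)) (by fun_prop) fun t ht => ⟨hr₀mem, ht⟩)
    (fun t ht => hPpos (r₀, t) ⟨hr₀mem, ht⟩)
    (fun z hz => by simpa [hLbot r₀ hr₀mem] using hver r₀ hr₀mem (-1) hbot z hz)
  have hGinv : ∀ p ∈ Rect r₀ r₁, Linv (L p) = G (L p) ∧ G (L p) ∈ Icc (-1 : ℝ) 1 := by
    intro p hp
    obtain ⟨z, hz, hzp⟩ := (hbij r₀ hr₀mem).surjOn ((hbij p.1 hp.1).mapsTo hp.2)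
    change L (r₀, z) = L p at hzp
    rw [← hzp, hLinv z hz, hGL z hz]
    exact ⟨rfl, hz⟩
  have hLC : ContDiffOn ℝ 1 L (Rect r₀ r₁) := by
    rw [show (1 : WithTop ℕ∞) = 0 + 1 from rfl,
      contDiffOn_succ_iff_hasFDerivWithinAt_of_uniqueDiffOn hR]
    refine ⟨by simp, _, contDiffOn_zero.2 ?_, hLder⟩
    exact (hQC.continuousOn.neg.smul continuousOn_const).add
      (hPC.continuousOn.smul continuousOn_const)
  have hGLC : ContDiffOn ℝ 1 (fun p => G (L p)) (Rect r₀ r₁) := hG.comp_contDiffOn hLC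
  refine ⟨?_, fun p hp => ?_, fun z hz => by rw [div_self hr₀.ne', one_mul, hLinv z hz]⟩
  · refine ContDiffOn.congr (f := fun p => r₀ / p.1 * g (G (L p))) ?_
      fun p hp => by rw [(hGinv p hp).1]
    exact (contDiffOn_const.div contDiff_fst.contDiffOn fun p hp => (hrpos p hp).ne').mul
      (hg.comp hGLC fun p hp => (hGinv p hp).2)
  · have hnhds : Rect r₀ r₁ ∈ nhds p :=
      Filter.mem_of_superset ((isOpen_Ioo.prod isOpen_Ioo).mem_nhds hp)
        (prod_mono Ioo_subset_Icc_self Ioo_subset_Icc_self)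
    have hpR : p ∈ Rect r₀ r₁ := mem_of_mem_nhds hnhds
    have hGd : HasDerivWithinAt G (deriv G (L p)) univ (L p) :=
      ((hG.differentiable one_ne_zero) (L p)).hasDerivAt.hasDerivWithinAt
    have hgd := ((hg.differentiableOn one_ne_zero) (G (L p)) (hGinv p hpR).2).hasDerivWithinAt
    have hcomp := ((hgd.comp_hasFDerivWithinAt p
      (hGd.comp_hasFDerivWithinAt p (hLder p hpR) (mapsTo_univ _ _))
      fun q hq => (hGinv q hq).2).hasFDerivAt hnhds).const_mul r₀
    have heq : (fun q : ℝ × ℝ => q.1 * ((r₀ / q.1) * g (Linv (L q)))) =ᶠ[nhds p]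
        fun q => r₀ * (g ∘ G ∘ L) q := by
      filter_upwards [hnhds] with q hq
      have := (hrpos q hq).ne'
      rw [(hGinv q hq).1, ← mul_assoc, mul_div_cancel₀ _ this]
      rfl
    rw [(hcomp.congr_of_eventuallyEq heq).fderiv]
    simp only [add_apply, smul_apply,
      ContinuousLinearMap.coe_fst', ContinuousLinearMap.coe_snd', smul_eq_mul]
    ring
end
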